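/- Let t ∈ ℂ be transcendental over ℚ. Then in Mat_{(m+n)^r}(ℂ) the specialized algebras are mutual centralizers: 𝒢_t = { X : XY = YX for all Y ∈ 𝒮_t } and 𝒮_t = { X : XY = YX for all Y ∈ 𝒢_t }. -/

import Mathlib

set_option synthInstance.maxHeartbeats 1000000
set_option maxHeartbeats 1000000

open scoped BigOperators Kronecker

section CommonDefs

variable {R : Type*} [CommRing R]

/-- ℤ₂-degree of the basis vector `v_{k+1}` (0-based index `k`): `0` if `k < m`, else `1`. -/
def deg (m : ℕ) {N : ℕ} (k : Fin N) : ℕ := if (k : ℕ) < m then 0 else 1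

/-- The sign `(−1)^{|v_k||v_l|}`. -/
def sgn (R : Type*) [CommRing R] (m : ℕ) {N : ℕ} (k l : Fin N) : R :=
  (-1 : R) ^ (deg m k * deg m l)

/-- Entries (row = input vector) of the operator `T` on `V ⊗ V`, where `x` plays the
role of `q` and `xinv` that of `q⁻¹`:  `T(v_k ⊗ v_k) = q·v_k ⊗ v_k` if `k ≤ m`,
`T(v_k ⊗ v_k) = −q⁻¹·v_k ⊗ v_k` if `k > m`,
`T(v_k ⊗ v_l) = (−1)^{|v_k||v_l|} v_l ⊗ v_k + (q−q⁻¹) v_k ⊗ v_l` if `k < l`, and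
`T(v_k ⊗ v_l) = (−1)^{|v_k||v_l|} v_l ⊗ v_k` if `k > l`. -/
def Tent (x xinv : R) (m : ℕ) {N : ℕ} (p p' : Fin N × Fin N) : R :=
  if p.1 = p.2 then (if (p.1 : ℕ) < m then x else -xinv) * (if p' = p then 1 else 0)
  else if (p.1 : ℕ) < (p.2 : ℕ) then
    sgn R m p.1 p.2 * (if p' = (p.2, p.1) then 1 else 0)
      + (x - xinv) * (if p' = p then 1 else 0)
  else sgn R m p.1 p.2 * (if p' = (p.2, p.1) then 1 else 0)

/-- Entries of the signed swap `P(v_k ⊗ v_l) = (−1)^{|v_k||v_l|} v_l ⊗ v_k`. -/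
def Pent (R : Type*) [CommRing R] (m : ℕ) {N : ℕ} (p p' : Fin N × Fin N) : R :=
  sgn R m p.1 p.2 * (if p' = (p.2, p.1) then 1 else 0)

/-- The operator `Id^{⊗ i} ⊗ E ⊗ Id^{⊗ (r−i−2)}` on `V^{⊗ r}` obtained from a two-site
operator `E` acting on the (0-based) tensor positions `i` and `i+1`. -/
def twoSiteOp {N : ℕ} (E : Fin N × Fin N → Fin N × Fin N → R) (r i : ℕ) (h : i + 1 < r) :
    Matrix (Fin r → Fin N) (Fin r → Fin N) R := fun a b =>
  E (a ⟨i, Nat.lt_of_succ_lt h⟩, a ⟨i + 1, h⟩) (b ⟨i, Nat.lt_of_succ_lt h⟩, b ⟨i + 1, h⟩) *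
    ∏ j ∈ Finset.univ \ ({⟨i, Nat.lt_of_succ_lt h⟩, ⟨i + 1, h⟩} : Finset (Fin r)),
      (if a j = b j then (1 : R) else 0)

/-- The Hecke operator `T_{i+1} = Id^{⊗ i} ⊗ T ⊗ Id^{⊗ (r−i−2)}` on `V^{⊗ r}`
(here `i` is the 0-based position of the first tensor factor it acts on). -/
def heckeOp (x xinv : R) (m : ℕ) {N : ℕ} (r i : ℕ) (h : i + 1 < r) :
    Matrix (Fin r → Fin N) (Fin r → Fin N) R :=
  twoSiteOp (Tent x xinv m) r i h

/-- The signed swap operator `P_{i+1} = Id^{⊗ i} ⊗ P ⊗ Id^{⊗ (r−i−2)}` on `V^{⊗ r}`. -/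
def swapOp (R : Type*) [CommRing R] (m : ℕ) {N : ℕ} (r i : ℕ) (h : i + 1 < r) :
    Matrix (Fin r → Fin N) (Fin r → Fin N) R :=
  twoSiteOp (Pent R m) r i h

/-- The parity operator `S v_j = (−1)^{|v_j|} v_j`. -/
def Smat (R : Type*) [CommRing R] (m : ℕ) {N : ℕ} : Matrix (Fin N) (Fin N) R :=
  fun a b => if a = b then (-1 : R) ^ deg m a else 0

/-- The diagonal operator `Q_b v_j = q^{δ_{bj}} v_j` (`x` playing the role of `q`, or of
`q⁻¹` for the inverse operator). -/
def Qmat (x : R) {N : ℕ} (b0 : Fin N) : Matrix (Fin N) (Fin N) R :=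
  fun a b => if a = b then (if a = b0 then x else 1) else 0

/-- `E_k v_{k+1} = v_k`, `E_k v_j = 0` otherwise (0-based `k`; row = input). -/
def Emat (R : Type*) [CommRing R] {N : ℕ} (k : ℕ) : Matrix (Fin N) (Fin N) R :=
  fun a b => if (a : ℕ) = k + 1 ∧ (b : ℕ) = k then 1 else 0

/-- `F_k v_k = v_{k+1}`, `F_k v_j = 0` otherwise (0-based `k`; row = input). -/
def Fmat (R : Type*) [CommRing R] {N : ℕ} (k : ℕ) : Matrix (Fin N) (Fin N) R :=
  fun a b => if (a : ℕ) = k ∧ (b : ℕ) = k + 1 then 1 else 0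

/-- The diagonal operator `D_k v_j = q^{s(k)δ_{kj} − s(k+1)δ_{k+1,j}} v_j`
(0-based `k`, so `s(k) = 1` iff `k < m`, and `s(k) = −1` otherwise). -/
def Dmat (x xinv : R) (m : ℕ) {N : ℕ} (k : ℕ) : Matrix (Fin N) (Fin N) R :=
  fun a b => if a = b then
    (if (a : ℕ) = k then (if k < m then x else xinv)
     else if (a : ℕ) = k + 1 then (if k + 1 < m then xinv else x) else 1)
  else 0

/-- The inverse `D_k⁻¹` of `Dmat` (obtained by exchanging `q` and `q⁻¹`). -/
def Dinvmat (x xinv : R) (m : ℕ) {N : ℕ} (k : ℕ) : Matrix (Fin N) (Fin N) R :=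
  Dmat xinv x m k

/-- `S^{p(k)}`, where `p(k) = 1` if the 0-based `k` satisfies `k + 1 = m` (the odd simple
root) and `p(k) = 0` otherwise. -/
def SPmat (R : Type*) [CommRing R] (m : ℕ) {N : ℕ} (k : ℕ) : Matrix (Fin N) (Fin N) R :=
  if k + 1 = m then Smat R m else 1

/-- Kronecker (tensor) product of `r` one-site operators, as a matrix on `V^{⊗ r}`. -/
def kron {N r : ℕ} (M : Fin r → Matrix (Fin N) (Fin N) R) :
    Matrix (Fin r → Fin N) (Fin r → Fin N) R :=
  fun a b => ∏ j, M j (a j) (b j)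

/-- `ρ_r(σ) = S^{⊗ r}`. -/
def rhoSigma (R : Type*) [CommRing R] (m : ℕ) {N : ℕ} (r : ℕ) :
    Matrix (Fin r → Fin N) (Fin r → Fin N) R :=
  kron fun _ => Smat R m

/-- `ρ_r(q^{δ_b}) = Q_b^{⊗ r}` (and its inverse, substituting `q⁻¹` for `x`). -/
def rhoQ (x : R) {N : ℕ} (r : ℕ) (b0 : Fin N) :
    Matrix (Fin r → Fin N) (Fin r → Fin N) R :=
  kron fun _ => Qmat x b0

/-- `ρ_r(e_k) = Σ_{j=1}^{r} (S^{p(k)})^{⊗(j−1)} ⊗ E_k ⊗ (D_k^{−1})^{⊗(r−j)}`. -/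
def rhoE (x xinv : R) (m : ℕ) {N : ℕ} (r : ℕ) (k : ℕ) :
    Matrix (Fin r → Fin N) (Fin r → Fin N) R :=
  ∑ p : Fin r, kron fun j =>
    if j < p then SPmat R m k else if j = p then Emat R k else Dinvmat x xinv m k

/-- `ρ_r(f_k) = Σ_{j=1}^{r} (S^{p(k)}D_k)^{⊗(j−1)} ⊗ F_k ⊗ Id^{⊗(r−j)}`. -/
def rhoF (x xinv : R) (m : ℕ) {N : ℕ} (r : ℕ) (k : ℕ) :
    Matrix (Fin r → Fin N) (Fin r → Fin N) R :=
  ∑ p : Fin r, kron fun j =>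
    if j < p then SPmat R m k * Dmat x xinv m k else if j = p then Fmat R k else 1

/-- The generators `T_1, …, T_{r−1}` of the image of the sign `q`-permutation
representation of the Iwahori–Hecke algebra on `V^{⊗ r}`. -/
def heckeGens (x xinv : R) (m : ℕ) {N : ℕ} (r : ℕ) :
    Set (Matrix (Fin r → Fin N) (Fin r → Fin N) R) :=
  {M | ∃ (i : ℕ) (h : i + 1 < r), M = heckeOp x xinv m r i h}

/-- The signed-swap generators `P_1, …, P_{r−1}` (the `q → 1` specialization). -/
def swapGens (R : Type*) [CommRing R] (m : ℕ) {N : ℕ} (r : ℕ) :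
    Set (Matrix (Fin r → Fin N) (Fin r → Fin N) R) :=
  {M | ∃ (i : ℕ) (h : i + 1 < r), M = swapOp R m r i h}

/-- The generators `ρ_r(σ)`, `ρ_r(q^{± δ_b})` (`1 ≤ b ≤ N`), `ρ_r(e_k)`, `ρ_r(f_k)`
(`1 ≤ k ≤ N−1`) of the image of the vector representation of `U_q^σ(gl(m,n))`. -/
def quantumGens (x xinv : R) (m : ℕ) {N : ℕ} (r : ℕ) :
    Set (Matrix (Fin r → Fin N) (Fin r → Fin N) R) :=
  {rhoSigma R m r} ∪ (Set.range fun b : Fin N => rhoQ x r b)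
    ∪ (Set.range fun b : Fin N => rhoQ xinv r b)
    ∪ (Set.range fun k : Fin (N - 1) => rhoE x xinv m r (k : ℕ))
    ∪ (Set.range fun k : Fin (N - 1) => rhoF x xinv m r (k : ℕ))

end CommonDefs

/-- The specialized algebra `𝒮_t ⊆ Mat_{(m+n)^r}(ℂ)`, generated by the Hecke operators
with `q` replaced by the nonzero complex number `t`. -/
noncomputable def St (t : ℂ) (m n r : ℕ) :
    Subalgebra ℂ (Matrix (Fin r → Fin (m + n)) (Fin r → Fin (m + n)) ℂ) :=
  Algebra.adjoin ℂ (heckeGens t t⁻¹ m (N := m + n) r)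

/-- The specialized algebra `𝒢_t ⊆ Mat_{(m+n)^r}(ℂ)`, generated by the operators of the
vector representation with `q` replaced by the nonzero complex number `t`. -/
noncomputable def Gt (t : ℂ) (m n r : ℕ) :
    Subalgebra ℂ (Matrix (Fin r → Fin (m + n)) (Fin r → Fin (m + n)) ℂ) :=
  Algebra.adjoin ℂ (quantumGens t t⁻¹ m (N := m + n) r)

section Specialization

variable {R K L : Type*} [CommRing R] [Field K] [Field L] [Algebra K R]

theorem Matrix.exists_mul_mul_eq_one_of_rank {I J : Type*} [Fintype I] [Fintype J]
    [DecidableEq I] [DecidableEq J] (M : Matrix I J K) :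
    ∃ (P : Matrix (Fin M.rank) I K) (Q : Matrix J (Fin M.rank) K), P * M * Q = 1 := by
  let b : Module.Basis (Fin M.rank) K (LinearMap.range M.mulVecLin) := Module.finBasis K _
  have hb : ∀ k, ∃ q, M.mulVecLin q = b k := fun k => (b k).2
  choose q hq using hb
  let Q : Matrix J (Fin M.rank) K := Matrix.of fun j k => q k j
  have hcol : (M * Q).col = fun k => (b k : I → K) := by
    funext k i
    rw [← hq k]
    rfl
  have hli : LinearIndependent K (M * Q).col := by
    rw [hcol]
    exact b.linearIndependent.map' (Submodule.subtype _) (Submodule.ker_subtype _)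
  have hinj : LinearMap.ker (M * Q).mulVecLin = ⊥ :=
    LinearMap.ker_eq_bot.2 (Matrix.mulVec_injective_iff.2 hli)
  obtain ⟨p, hp⟩ := LinearMap.exists_leftInverse_of_injective _ hinj
  refine ⟨LinearMap.toMatrix' p, Q, ?_⟩
  have := congrArg LinearMap.toMatrix' hp
  rw [LinearMap.toMatrix'_comp, LinearMap.toMatrix'_id] at this
  rw [Matrix.mul_assoc, ← this]
  congr 1
  exact (LinearMap.toMatrix'_toLin' _).symm

theorem Matrix.rank_map_le_rank_map {I J : Type*} [Fintype I] [Fintype J]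
    [DecidableEq I] [DecidableEq J] (φ : R →ₐ[K] K) (ψ : R →+* L)
    (hψ : Function.Injective ψ) (M : Matrix I J R) :
    (M.map φ).rank ≤ (M.map ψ).rank := by
  obtain ⟨P, Q, h⟩ := (M.map φ).exists_mul_mul_eq_one_of_rank
  have hφ : ∀ x : K, φ (algebraMap K R x) = x := fun x => by simp
  set D := P.map (algebraMap K R) * M * Q.map (algebraMap K R) with hD
  have hD1 : D.map φ = 1 := by
    rw [hD, Matrix.map_mul, Matrix.map_mul, Matrix.map_map, Matrix.map_map]
    have : (φ : R → K) ∘ (algebraMap K R) = id := funext hφ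
    rw [this, Matrix.map_id, Matrix.map_id, h]
  have hdet : D.det ≠ 0 := by
    intro h0
    have h1 : φ D.det = 1 := by
      rw [AlgHom.map_det]
      change (D.map φ).det = 1
      rw [hD1, Matrix.det_one]
    rw [h0, map_zero] at h1
    exact zero_ne_one h1
  have hdetψ : (D.map ψ).det ≠ 0 := by
    have : (D.map ψ).det = ψ D.det := (RingHom.map_det ψ D).symm
    rw [this]
    exact (map_ne_zero_iff ψ hψ).2 hdet
  have hr : (D.map ψ).rank = (M.map φ).rank := by
    rw [Matrix.rank_of_isUnit _ ((Matrix.isUnit_iff_isUnit_det _).2 hdetψ.isUnit)]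
    simp
  rw [← hr, hD, Matrix.map_mul, Matrix.map_mul]
  exact (Matrix.rank_mul_le_left _ _).trans (Matrix.rank_mul_le_right _ _)

variable {I : Type*} [Fintype I] [DecidableEq I]

/-- A square matrix as the vector of its entries. -/
def Matrix.entriesEquiv (L I : Type*) [Semiring L] : Matrix I I L ≃ₗ[L] (I × I → L) where
  toFun X p := X p.1 p.2
  invFun v := Matrix.of fun a b => v (a, b)
  map_add' _ _ := rfl
  map_smul' _ _ := rfl
  left_inv _ := rfl
  right_inv _ := rfl

theorem finrank_adjoin_map_le (φ : R →ₐ[K] K) (ψ : R →+* L)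
    (hψ : Function.Injective ψ) {ι : Type*} (g : ι → Matrix I I R) :
    Module.finrank K (Algebra.adjoin K (Set.range fun i => (g i).map φ)) ≤
      Module.finrank L (Algebra.adjoin L (Set.range fun i => (g i).map ψ)) := by
  have himg : ∀ x ∈ Submonoid.closure (Set.range fun i => (g i).map φ),
      ∃ w ∈ Submonoid.closure (Set.range g), w.map φ = x := by
    intro x hx
    have h1 : (Set.range fun i => (g i).map φ) =
        (φ : R →+* K).mapMatrix.toMonoidHom '' Set.range g := by
      rw [← Set.range_comp]; rfl
    rw [h1, ← MonoidHom.map_mclosure] at hx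
    obtain ⟨w, hw, rfl⟩ := hx
    exact ⟨w, hw, rfl⟩
  obtain ⟨b, hbs, hspan, hli⟩ := exists_linearIndependent K
    (Submonoid.closure (Set.range fun i => (g i).map φ) : Set (Matrix I I K))
  have : Finite b := hli.finite
  have := Fintype.ofFinite b
  classical
  have hw : ∀ x : b, ∃ w ∈ Submonoid.closure (Set.range g), w.map φ = x.1 :=
    fun x => himg _ (hbs x.2)
  choose w hwc hwφ using hw
  let W : Matrix b (I × I) R := Matrix.of fun x p => w x p.1 p.2
  have hcard : Module.finrank K (Algebra.adjoin K (Set.range fun i => (g i).map φ)) =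
      Fintype.card b := by
    rw [← Subalgebra.finrank_toSubmodule, Algebra.adjoin_eq_span, ← hspan]
    rw [← finrank_span_eq_card hli, Subtype.range_coe]
  have hrow1 : (W.map φ).rank = Fintype.card b := by
    apply LinearIndependent.rank_matrix
    have : (W.map φ).row = fun x : b => (Matrix.entriesEquiv K I) x.1 := by
      funext x p
      rw [← hwφ x]
      rfl
    rw [this]
    exact hli.map' (Matrix.entriesEquiv K I).toLinearMap (LinearEquiv.ker _)
  rw [hcard, ← hrow1]
  refine (Matrix.rank_map_le_rank_map φ ψ hψ W).trans ?_
  rw [Matrix.rank_eq_finrank_span_row, ← Subalgebra.finrank_toSubmodule,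
    ← LinearEquiv.finrank_map_eq (Matrix.entriesEquiv L I) (Subalgebra.toSubmodule _)]
  apply Submodule.finrank_mono
  rw [Submodule.span_le]
  rintro _ ⟨x, rfl⟩
  refine ⟨(w x).map ψ, ?_, rfl⟩
  have h2 : (Set.range fun i => (g i).map ψ) =
      ψ.mapMatrix.toMonoidHom '' Set.range g := by
    rw [← Set.range_comp]; rfl
  have h3 : (w x).map ψ ∈ Submonoid.closure (Set.range fun i => (g i).map ψ) := by
    rw [h2, ← MonoidHom.map_mclosure]
    exact ⟨w x, hwc x, rfl⟩
  have h4 : Submonoid.closure (Set.range fun i => (g i).map ψ) ≤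
      (Algebra.adjoin L (Set.range fun i => (g i).map ψ)).toSubmonoid :=
    Submonoid.closure_le.2 Algebra.subset_adjoin
  exact h4 h3

/-- The matrix of the linear system `g i * X = X * g i` in the entries of `X`. -/
def commutantSystem {ι : Type*} (g : ι → Matrix I I R) : Matrix (ι × I × I) (I × I) R :=
  Matrix.of fun k p => (if p.2 = k.2.2 then g k.1 k.2.1 p.1 else 0) -
    (if k.2.1 = p.1 then g k.1 p.2 k.2.2 else 0)

theorem commutantSystem_mulVec {ι : Type*} (g : ι → Matrix I I L) (X : Matrix I I L)
    (k : ι × I × I) :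
    (commutantSystem g).mulVec (fun p => X p.1 p.2) k =
      (g k.1 * X - X * g k.1) k.2.1 k.2.2 := by
  simp only [commutantSystem, Matrix.mulVec, dotProduct, Matrix.of_apply, sub_mul,
    Finset.sum_sub_distrib, Matrix.sub_apply, Matrix.mul_apply, Fintype.sum_prod_type]
  congr 1
  · simp
  · rw [Finset.sum_comm]
    simp [mul_comm]

theorem finrank_centralizer_eq {ι : Type*} [Fintype ι] (g : ι → Matrix I I L) :
    Module.finrank L (Subalgebra.centralizer L (Set.range g)) =
      Fintype.card (I × I) - (commutantSystem g).rank := by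
  have h1 : (Subalgebra.toSubmodule (Subalgebra.centralizer L (Set.range g))).map
      (Matrix.entriesEquiv L I).toLinearMap =
      LinearMap.ker (commutantSystem g).mulVecLin := by
    ext v
    constructor
    · rintro ⟨X, hX, rfl⟩
      rw [LinearMap.mem_ker]
      funext k
      change (commutantSystem g).mulVec (fun p => X p.1 p.2) k = 0
      rw [commutantSystem_mulVec, (Subalgebra.mem_centralizer_iff L).1 hX _ ⟨k.1, rfl⟩, sub_self]
      rfl
    · intro hv
      refine ⟨Matrix.of fun a b => v (a, b), ?_, rfl⟩
      refine (Subalgebra.mem_centralizer_iff L).2 ?_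
      rintro _ ⟨i, rfl⟩
      ext a c
      have h2 := congrFun (LinearMap.mem_ker.1 hv) (i, a, c)
      have h3 := commutantSystem_mulVec g (Matrix.of fun a b => v (a, b)) (i, a, c)
      exact sub_eq_zero.1 (h3.symm.trans h2)
  rw [← Subalgebra.finrank_toSubmodule,
    ← LinearEquiv.finrank_map_eq (Matrix.entriesEquiv L I) (Subalgebra.toSubmodule _)]
  have h4 := LinearMap.finrank_range_add_finrank_ker (commutantSystem g).mulVecLin
  rw [Module.finrank_fintype_fun_eq_card, ← h1] at h4
  have h5 : (commutantSystem g).rank =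
    Module.finrank L (LinearMap.range (commutantSystem g).mulVecLin) := rfl
  rw [h5]
  exact Nat.eq_sub_of_add_eq' h4

omit [Fintype I] in
theorem commutantSystem_map {S : Type*} [CommRing S] (f : R →+* S) {ι : Type*}
    (g : ι → Matrix I I R) :
    (commutantSystem g).map f = commutantSystem fun i => (g i).map f := by
  ext k p
  simp [commutantSystem, apply_ite f]

theorem finrank_centralizer_map_le (φ : R →ₐ[K] K) (ψ : R →+* L)
    (hψ : Function.Injective ψ) {ι : Type*} [Finite ι] (g : ι → Matrix I I R) :
    Module.finrank L (Subalgebra.centralizer L (Set.range fun i => (g i).map ψ)) ≤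
      Module.finrank K (Subalgebra.centralizer K (Set.range fun i => (g i).map φ)) := by
  have := Fintype.ofFinite ι
  classical
  rw [finrank_centralizer_eq, finrank_centralizer_eq]
  refine Nat.sub_le_sub_left ?_ _
  rw [← commutantSystem_map ψ g]
  have := commutantSystem_map (φ : R →+* K) g
  change _ = commutantSystem fun i => (g i).map φ at this
  rw [← this]
  exact Matrix.rank_map_le_rank_map φ ψ hψ _

theorem adjoin_eq_centralizer_of_specialization (φ : R →ₐ[K] K) (ψ : R →+* L)
    (hψ : Function.Injective ψ) {ι κ : Type*} [Finite κ]
    (g : ι → Matrix I I R) (h : κ → Matrix I I R)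
    (hcomm : Algebra.adjoin L (Set.range fun i => (g i).map ψ) ≤
      Subalgebra.centralizer L (Set.range fun i => (h i).map ψ))
    (hone : Subalgebra.centralizer K (Set.range fun i => (h i).map φ) ≤
      Algebra.adjoin K (Set.range fun i => (g i).map φ)) :
    Algebra.adjoin L (Set.range fun i => (g i).map ψ) =
      Subalgebra.centralizer L (Set.range fun i => (h i).map ψ) := by
  apply Subalgebra.eq_of_le_of_finrank_le hcomm
  refine (finrank_centralizer_map_le φ ψ hψ h).trans (le_trans ?_ (finrank_adjoin_map_le φ ψ hψ g))
  exact Submodule.finrank_mono (Subalgebra.toSubmodule.monotone hone)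

end Specialization

section DoubleCentralizer

variable {K : Type*} [Field K] [LinearOrder K] [IsStrictOrderedRing K]
variable {I : Type*} [Fintype I] [DecidableEq I]

omit [DecidableEq I] in
theorem Matrix.isCompl_orthogonal_trace (A : Submodule K (Matrix I I K)) :
    ∃ B : Submodule K (Matrix I I K), IsCompl A B ∧
      ∀ Y, Y ∈ B ↔ ∀ X ∈ A, (X.transpose * Y).trace = 0 := by
  let β : LinearMap.BilinForm K (Matrix I I K) :=
    LinearMap.mk₂ K (fun X Y => (X.transpose * Y).trace)
      (by intros; simp [Matrix.add_mul]) (by intros; simp)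
      (by intros; simp [Matrix.mul_add]) (by intros; simp)
  have hsymm : β.IsSymm := ⟨fun X Y => by
    change (X.transpose * Y).trace = (Y.transpose * X).trace
    rw [← Matrix.trace_transpose, Matrix.transpose_mul, Matrix.transpose_transpose]⟩
  have hdef : ∀ X, β X X = 0 → X = 0 := by
    intro X hX
    have h1 : ∑ b, ∑ a, X a b * X a b = 0 := hX
    ext a b
    have h2 := (Finset.sum_eq_zero_iff_of_nonneg
      (fun b _ => Finset.sum_nonneg fun a _ => mul_self_nonneg (X a b))).1 h1 b (Finset.mem_univ _)
    have h3 := (Finset.sum_eq_zero_iff_of_nonneg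
      (fun a _ => mul_self_nonneg (X a b))).1 h2 a (Finset.mem_univ _)
    exact mul_self_eq_zero.1 h3
  refine ⟨β.orthogonal A, ?_, fun Y => Iff.rfl⟩
  apply LinearMap.BilinForm.isCompl_orthogonal_of_restrict_nondegenerate hsymm.isRefl
  constructor
  · intro x hx
    exact Subtype.ext (hdef _ (hx x))
  · intro x hx
    exact Subtype.ext (hdef _ (hx x))

theorem Subalgebra.centralizer_centralizer_le_of_transpose_mem
    (A : Subalgebra K (Matrix I I K)) (hA : ∀ X ∈ A, X.transpose ∈ A) :
    Subalgebra.centralizer K (Subalgebra.centralizer K (A : Set (Matrix I I K)) :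
      Set (Matrix I I K)) ≤ A := by
  intro Z hZ
  obtain ⟨B, hAB, hB⟩ := Matrix.isCompl_orthogonal_trace (Subalgebra.toSubmodule A)
  let π : Matrix I I K →ₗ[K] Matrix I I K := (Subalgebra.toSubmodule A).subtype ∘ₗ
    Submodule.projectionOnto _ _ hAB
  have hπmem : ∀ Y, π Y ∈ A := fun Y => (Submodule.projectionOnto _ _ hAB Y).2
  have hπA : ∀ Y ∈ A, π Y = Y := fun Y hY => by
    have := Submodule.projectionOnto_apply_left hAB ⟨Y, hY⟩
    exact congrArg Subtype.val this
  have hπB : ∀ Y ∈ B, π Y = 0 := fun Y hY => by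
    have := (Submodule.projectionOnto_apply_eq_zero_iff hAB).2 hY
    exact congrArg Subtype.val this
  have hBmul : ∀ X ∈ A, ∀ Y ∈ B, X * Y ∈ B := by
    intro X hX Y hY
    rw [hB] at hY ⊢
    intro W hW
    have := hY (X.transpose * W) (A.mul_mem (hA X hX) hW)
    rwa [Matrix.transpose_mul, Matrix.transpose_transpose, Matrix.mul_assoc] at this
  have hπmul : ∀ X ∈ A, ∀ Y, π (X * Y) = X * π Y := by
    intro X hX Y
    have hYtop : Y ∈ (Subalgebra.toSubmodule A) ⊔ B := hAB.sup_eq_top ▸ Submodule.mem_top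
    obtain ⟨y, hy, z, hz, rfl⟩ := Submodule.mem_sup.1 hYtop
    rw [mul_add, map_add, map_add, hπA _ (A.mul_mem hX hy), hπA y hy, hπB z hz,
      hπB _ (hBmul X hX z hz), add_zero, add_zero]
  let C : I → I → Matrix I I K := fun b d => Matrix.of fun a c => π (Matrix.single c d 1) a b
  have hπC : ∀ Y a b, π Y a b = ∑ d, (C b d * Y) a d := by
    intro Y a b
    conv_lhs => rw [Matrix.matrix_eq_sum_single Y]
    simp only [map_sum, Matrix.sum_apply, Matrix.mul_apply]
    rw [Finset.sum_comm]
    refine Finset.sum_congr rfl fun d _ => Finset.sum_congr rfl fun c _ => ?_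
    have : Matrix.single c d (Y c d) = Y c d • Matrix.single c d (1 : K) := by simp
    rw [this, map_smul, Matrix.smul_apply, smul_eq_mul, mul_comm]
    rfl
  have hC : ∀ b d, C b d ∈ Subalgebra.centralizer K (A : Set (Matrix I I K)) := by
    intro b d
    refine (Subalgebra.mem_centralizer_iff K).2 fun X hX => ?_
    ext a e
    have h1 := congrFun (congrFun (hπmul X hX (Matrix.single e d 1)) a) b
    have h2 : X * Matrix.single e d 1 = ∑ c, X c e • Matrix.single c d (1 : K) := by
      ext u v
      rw [Matrix.mul_single_eq_updateCol_zero, Matrix.sum_apply]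
      simp [Matrix.single_apply, Matrix.updateCol_apply, eq_comm, ite_and]
    rw [h2, map_sum, Matrix.sum_apply, Matrix.mul_apply] at h1
    rw [Matrix.mul_apply, Matrix.mul_apply]
    refine h1.symm.trans (Finset.sum_congr rfl fun c _ => ?_)
    rw [map_smul, Matrix.smul_apply, smul_eq_mul, mul_comm]
    rfl
  have hZπ : π Z = Z * π 1 := by
    ext a b
    rw [hπC, Matrix.mul_apply]
    simp_rw [hπC 1, Matrix.mul_one, Finset.mul_sum]
    rw [Finset.sum_comm]
    refine Finset.sum_congr rfl fun d _ => ?_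
    rw [(Subalgebra.mem_centralizer_iff K).1 hZ _ (hC b d), Matrix.mul_apply]
  rw [hπA 1 A.one_mem, mul_one] at hZπ
  rw [← hZπ]
  exact hπmem Z

end DoubleCentralizer

section Placements

variable {K A ι α : Type*} [CommRing K] [Ring A] [Algebra K A] [Fintype ι] [DecidableEq ι]

/-- Place `x` at a position outside `J`, in all possible ways, to the left of `F`. -/
def placeOp (K : Type*) [CommRing K] [Algebra K A] (X : ι → α → α → A) (x : α × α) :
    (Finset ι → A) →ₗ[K] (Finset ι → A) where
  toFun F J := ∑ j ∈ Jᶜ, X j x.1 x.2 * F (insert j J)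
  map_add' F G := by
    funext J
    simp [mul_add, Finset.sum_add_distrib]
  map_smul' c F := by
    funext J
    simp [Finset.smul_sum]

/-- Left multiplication by the sum of the `X j x` over the positions `j` outside `J`. -/
def coproductOp (K : Type*) [CommRing K] [Algebra K A] (X : ι → α → α → A) (x : α × α) :
    (Finset ι → A) →ₗ[K] (Finset ι → A) where
  toFun F J := (∑ j ∈ Jᶜ, X j x.1 x.2) * F J
  map_add' F G := by
    funext J
    simp [mul_add]
  map_smul' c F := by
    funext J
    simp

/-- The sum of the products of the letters of a word over all placements of the letters at
distinct positions outside a given set. -/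
def placements (K : Type*) [CommRing K] [Algebra K A] (X : ι → α → α → A) :
    List (α × α) → Finset ι → A
  | [] => 1
  | x :: w => placeOp K X x (placements K X w)

variable {X : ι → α → α → A} {d : α → ℕ}

theorem placeOp_comm
    (hcomm : ∀ i j, i ≠ j → ∀ a b c e, X i a b * X j c e =
      (-1 : K) ^ ((d a + d b) * (d c + d e)) • (X j c e * X i a b))
    (x y : α × α) (F : Finset ι → A) :
    placeOp K X x (placeOp K X y F) =
      (-1 : K) ^ ((d x.1 + d x.2) * (d y.1 + d y.2)) • placeOp K X y (placeOp K X x F) := by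
  funext J
  change ∑ j ∈ Jᶜ, X j x.1 x.2 * (∑ l ∈ (insert j J)ᶜ, X l y.1 y.2 * F (insert l (insert j J))) =
    (-1 : K) ^ _ • ∑ l ∈ Jᶜ, X l y.1 y.2 *
      (∑ j ∈ (insert l J)ᶜ, X j x.1 x.2 * F (insert j (insert l J)))
  simp only [Finset.mul_sum, Finset.smul_sum]
  rw [Finset.sum_comm' (t' := Jᶜ) (s' := fun l => (insert l J)ᶜ)]
  · refine Finset.sum_congr rfl fun l _ => Finset.sum_congr rfl fun j hj => ?_
    have hne : j ≠ l := by
      rintro rfl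
      simp at hj
    rw [← mul_assoc, hcomm j l hne, Finset.insert_comm, ← mul_assoc, smul_mul_assoc]
  · intro j l
    simp only [Finset.mem_compl, Finset.mem_insert, not_or]
    tauto

theorem coproductOp_placeOp [DecidableEq α]
    (hmul : ∀ i a b c e, X i a b * X i c e = if b = c then X i a e else 0)
    (hcomm : ∀ i j, i ≠ j → ∀ a b c e, X i a b * X j c e =
      (-1 : K) ^ ((d a + d b) * (d c + d e)) • (X j c e * X i a b))
    (x y : α × α) (F : Finset ι → A) :
    coproductOp K X x (placeOp K X y F) =
      (-1 : K) ^ ((d x.1 + d x.2) * (d y.1 + d y.2)) • placeOp K X y (coproductOp K X x F) +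
        if x.2 = y.1 then placeOp K X (x.1, y.2) F else 0 := by
  have hif : (if x.2 = y.1 then placeOp K X (x.1, y.2) F else 0) =
      fun J => ∑ l ∈ Jᶜ, (if x.2 = y.1 then X l x.1 y.2 else 0) * F (insert l J) := by
    split_ifs
    · rfl
    · funext J
      simp
  rw [hif]
  funext J
  change (∑ j ∈ Jᶜ, X j x.1 x.2) * ∑ l ∈ Jᶜ, X l y.1 y.2 * F (insert l J) =
    ((-1 : K) ^ _ • ∑ l ∈ Jᶜ, X l y.1 y.2 * ((∑ j ∈ (insert l J)ᶜ, X j x.1 x.2) * F (insert l J))) + _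
  rw [Finset.mul_sum, Finset.smul_sum, ← Finset.sum_add_distrib]
  refine Finset.sum_congr rfl fun l hl => ?_
  have hJ : Jᶜ = insert l (insert l J)ᶜ := by
    ext j
    simp only [Finset.mem_compl, Finset.mem_insert, not_or] at hl ⊢
    by_cases h : j = l
    · simp [h, hl]
    · simp [h]
  rw [hJ, Finset.sum_insert (by simp), add_mul, ← mul_assoc, hmul, add_comm]
  congr 1
  rw [Finset.sum_mul, Finset.sum_mul, Finset.mul_sum, Finset.smul_sum]
  refine Finset.sum_congr rfl fun j hj => ?_
  have hne : j ≠ l := by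
    rintro rfl
    simp at hj
  rw [← mul_assoc, hcomm j l hne, smul_mul_assoc, mul_assoc]

theorem coproductOp_placements_sub_mem [DecidableEq α]
    (hmul : ∀ i a b c e, X i a b * X i c e = if b = c then X i a e else 0)
    (hcomm : ∀ i j, i ≠ j → ∀ a b c e, X i a b * X j c e =
      (-1 : K) ^ ((d a + d b) * (d c + d e)) • (X j c e * X i a b))
    (x : α × α) (w : List (α × α)) :
    coproductOp K X x (placements K X w) - placements K X (x :: w) ∈
      Submodule.span K (placements K X '' {w' | w'.length = w.length}) := by
  induction w with
  | nil =>
    have : coproductOp K X x (placements K X []) = placements K X [x] := by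
      funext J
      change (∑ j ∈ Jᶜ, X j x.1 x.2) * 1 = ∑ j ∈ Jᶜ, X j x.1 x.2 * 1
      simp
    rw [this, sub_self]
    exact Submodule.zero_mem _
  | cons y w ih =>
    have hΨ : ∀ z : α × α, ∀ F ∈ Submodule.span K (placements K X '' {w' | w'.length = w.length}),
        placeOp K X z F ∈
          Submodule.span K (placements K X '' {w' | w'.length = (y :: w).length}) := by
      intro z F hF
      have := Submodule.mem_map_of_mem (f := placeOp K X z) hF
      rw [Submodule.map_span] at this
      refine Submodule.span_mono ?_ this
      rintro _ ⟨_, ⟨w', hw', rfl⟩, rfl⟩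
      exact ⟨z :: w', by simpa using hw', rfl⟩
    have h1 : coproductOp K X x (placements K X (y :: w)) - placements K X (x :: y :: w) =
        (-1 : K) ^ ((d x.1 + d x.2) * (d y.1 + d y.2)) • placeOp K X y
          (coproductOp K X x (placements K X w) - placements K X (x :: w)) +
        if x.2 = y.1 then placeOp K X (x.1, y.2) (placements K X w) else 0 := by
      rw [map_sub, smul_sub]
      change coproductOp K X x (placeOp K X y _) - placeOp K X x (placeOp K X y _) =
        _ - _ • placeOp K X y (placeOp K X x _) + _
      rw [coproductOp_placeOp hmul hcomm, placeOp_comm hcomm x y]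
      abel
    rw [h1]
    refine Submodule.add_mem _ (Submodule.smul_mem _ _ (hΨ y _ ih)) ?_
    split_ifs
    · exact hΨ _ _ (Submodule.subset_span ⟨w, rfl, rfl⟩)
    · exact Submodule.zero_mem _

theorem placements_empty_mem [DecidableEq α]
    (hmul : ∀ i a b c e, X i a b * X i c e = if b = c then X i a e else 0)
    (hcomm : ∀ i j, i ≠ j → ∀ a b c e, X i a b * X j c e =
      (-1 : K) ^ ((d a + d b) * (d c + d e)) • (X j c e * X i a b))
    (G : Subalgebra K A) (hG : ∀ a b, ∑ j, X j a b ∈ G) (w : List (α × α)) :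
    placements K X w ∅ ∈ G := by
  induction hs : w.length generalizing w with
  | zero =>
    rw [List.length_eq_zero_iff] at hs
    subst hs
    exact G.one_mem
  | succ s ih =>
    obtain ⟨x, w, rfl⟩ := List.exists_cons_of_length_eq_add_one hs
    have hw : w.length = s := by simpa using hs
    have h1 := coproductOp_placements_sub_mem hmul hcomm x w
    have h2 : Submodule.span K (placements K X '' {w' | w'.length = w.length}) ≤
        (Subalgebra.toSubmodule G).comap
          (LinearMap.proj (R := K) (φ := fun _ : Finset ι => A) ∅) := by
      rw [Submodule.span_le]
      rintro _ ⟨w', hw', rfl⟩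
      exact ih w' (hw'.trans hw)
    have h3 : (coproductOp K X x (placements K X w) - placements K X (x :: w)) ∅ ∈ G := h2 h1
    have h4 : coproductOp K X x (placements K X w) ∅ ∈ G := by
      change (∑ j ∈ (∅ : Finset ι)ᶜ, X j x.1 x.2) * placements K X w ∅ ∈ G
      rw [Finset.compl_empty]
      exact G.mul_mem (hG _ _) (ih w hw)
    have h5 := G.sub_mem h4 h3
    rwa [Pi.sub_apply, sub_sub_cancel] at h5

open scoped Classical in
theorem placements_ofFn {s : ℕ} (w : Fin s → α × α) (J : Finset ι) :
    placements K X (List.ofFn w) J = ∑ f : Fin s → ι,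
      if Function.Injective f ∧ ∀ i, f i ∉ J then
        (List.ofFn fun i => X (f i) (w i).1 (w i).2).prod else 0 := by
  induction s generalizing J with
  | zero =>
    simp [placements, Function.injective_of_subsingleton]
  | succ s ih =>
    rw [List.ofFn_succ, ← (Fin.consEquiv fun _ => ι).sum_comp, Fintype.sum_prod_type]
    change ∑ j ∈ Jᶜ, X j (w 0).1 (w 0).2 * placements K X _ (insert j J) = _
    rw [← Finset.sum_subset (Finset.subset_univ Jᶜ)]
    · refine Finset.sum_congr rfl fun j hj => ?_
      rw [ih, Finset.mul_sum]
      refine Finset.sum_congr rfl fun f _ => ?_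
      have hiff : (Function.Injective (Fin.cons j f : Fin (s + 1) → ι) ∧
          ∀ i, (Fin.cons j f : Fin (s + 1) → ι) i ∉ J) ↔
          (Function.Injective f ∧ ∀ i, f i ∉ insert j J) := by
        rw [Fin.cons_injective_iff, Fin.forall_fin_succ]
        simp only [Fin.cons_zero, Fin.cons_succ, Finset.mem_insert, not_or, Set.mem_range,
          not_exists, forall_and]
        have : j ∉ J := by simpa using hj
        tauto
      change _ = if (Function.Injective (Fin.cons j f : Fin (s + 1) → ι) ∧
          ∀ i, (Fin.cons j f : Fin (s + 1) → ι) i ∉ J) then _ else _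
      rw [if_congr hiff rfl rfl, mul_ite, mul_zero, List.ofFn_succ, List.prod_cons]
      rfl
    · intro j _ hj
      refine Finset.sum_eq_zero fun f _ => if_neg fun h => hj ?_
      simpa using h.2 0

theorem placements_ofFn_empty {r : ℕ} {X : Fin r → α → α → A} (w : Fin r → α × α) :
    placements K X (List.ofFn w) ∅ = ∑ g : Equiv.Perm (Fin r),
      (List.ofFn fun i => X (g i) (w i).1 (w i).2).prod := by
  classical
  rw [placements_ofFn, ← Finset.sum_filter]
  symm
  refine Finset.sum_bij (fun g _ => g) ?_ ?_ ?_ ?_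
  · intro g _
    simp [g.injective]
  · intro g _ g' _ h
    exact DFunLike.coe_injective h
  · intro f hf
    have hf' : Function.Injective f := by simpa using hf
    exact ⟨Equiv.ofBijective f (Finite.injective_iff_bijective.1 hf'), Finset.mem_univ _, rfl⟩
  · intro g _
    rfl

end Placements

section TensorOperators

variable {R : Type*} [CommRing R] {N r : ℕ}

theorem kron_mul (M M' : Fin r → Matrix (Fin N) (Fin N) R) :
    kron M * kron M' = kron fun j => M j * M' j := by
  ext a c
  simp only [kron, Matrix.mul_apply, Finset.prod_univ_sum, Fintype.piFinset_univ,
    Finset.prod_mul_distrib]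

theorem kron_one : kron (fun _ : Fin r => (1 : Matrix (Fin N) (Fin N) R)) = 1 := by
  ext a b
  simp only [kron, Matrix.one_apply, Finset.prod_ite_zero, Finset.prod_const_one, funext_iff,
    Finset.mem_univ, true_imp_iff]

theorem kron_smul (c : Fin r → R) (M : Fin r → Matrix (Fin N) (Fin N) R) :
    kron (fun j => c j • M j) = (∏ j, c j) • kron M := by
  ext a b
  simp [kron, Finset.prod_mul_distrib]

theorem kron_eq_zero {M : Fin r → Matrix (Fin N) (Fin N) R} (j : Fin r) (h : M j = 0) :
    kron M = 0 := by
  ext a b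
  exact Finset.prod_eq_zero (Finset.mem_univ j) (by rw [h]; rfl)

theorem kron_diagonal (f : Fin r → Fin N → R) :
    kron (fun j => Matrix.diagonal (f j)) = Matrix.diagonal fun a => ∏ j, f j (a j) := by
  ext a b
  by_cases h : a = b
  · subst h
    simp [kron]
  · obtain ⟨j, hj⟩ := Function.ne_iff.1 h
    rw [Matrix.diagonal_apply_ne _ h]
    exact Finset.prod_eq_zero (Finset.mem_univ j) (Matrix.diagonal_apply_ne _ hj)

theorem kron_single (a b : Fin r → Fin N) :
    kron (fun j => Matrix.single (a j) (b j) (1 : R)) = Matrix.single a b 1 := by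
  ext c e
  simp only [kron, Matrix.single_apply, Finset.prod_ite_zero, Finset.prod_const_one, funext_iff,
    Finset.mem_univ, true_imp_iff, forall_and]

theorem prod_eq_mul_mul_prod_sdiff_pair {p q : Fin r} (hpq : p ≠ q) (f : Fin r → R) :
    ∏ j, f j = f p * f q * ∏ j ∈ Finset.univ \ {p, q}, f j := by
  rw [← Finset.prod_sdiff (Finset.subset_univ {p, q}), Finset.prod_pair hpq, mul_comm]

theorem sum_mul_prod_sdiff_pair {p q : Fin r} (hpq : p ≠ q) (f : Fin N × Fin N → R)
    (g : Fin r → Fin N → R) :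
    ∑ b : Fin r → Fin N, f (b p, b q) * ∏ j ∈ Finset.univ \ {p, q}, g j (b j) =
      (∑ x, f x) * ∏ j ∈ Finset.univ \ {p, q}, ∑ y, g j y := by
  let h : Fin N × Fin N → Fin r → Fin N → R := fun x j y =>
    if j = p then (if x.1 = y then 1 else 0) else if j = q then (if x.2 = y then 1 else 0)
      else g j y
  have hout : ∀ x, ∀ j ∈ Finset.univ \ {p, q}, h x j = g j := by
    intro x j hj
    simp only [Finset.mem_sdiff, Finset.mem_insert, Finset.mem_singleton, not_or] at hj
    funext y
    simp [h, hj.2.1, hj.2.2]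
  have h1 : ∀ x (b : Fin r → Fin N), ∏ j, h x j (b j) =
      (if x = (b p, b q) then 1 else 0) * ∏ j ∈ Finset.univ \ {p, q}, g j (b j) := by
    intro x b
    rw [prod_eq_mul_mul_prod_sdiff_pair hpq,
      Finset.prod_congr rfl fun j hj => congrFun (hout x j hj) (b j)]
    congr 1
    simp only [h, hpq.symm, Prod.ext_iff, ite_and, if_true, if_false, mul_ite, mul_one, mul_zero]
    split_ifs <;> rfl
  have h2 : ∀ x, ∏ j, ∑ y, h x j y = ∏ j ∈ Finset.univ \ {p, q}, ∑ y, g j y := by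
    intro x
    rw [prod_eq_mul_mul_prod_sdiff_pair hpq, Finset.prod_congr rfl fun j hj => by
      rw [hout x j hj]]
    simp [h, hpq.symm]
  have h3 : ∀ x, ∑ b : Fin r → Fin N, ∏ j, h x j (b j) =
      ∏ j ∈ Finset.univ \ {p, q}, ∑ y, g j y := by
    intro x
    rw [← h2 x, Finset.prod_univ_sum, Fintype.piFinset_univ]
  have h4 : ∀ x, f x * ∏ j ∈ Finset.univ \ {p, q}, ∑ y, g j y =
      ∑ b : Fin r → Fin N, f x * (if x = (b p, b q) then 1 else 0) *
        ∏ j ∈ Finset.univ \ {p, q}, g j (b j) := by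
    intro x
    rw [← h3 x, Finset.mul_sum]
    refine Finset.sum_congr rfl fun b _ => ?_
    rw [h1, mul_assoc]
  rw [Finset.sum_mul, Finset.sum_congr rfl fun x _ => h4 x, Finset.sum_comm]
  refine Finset.sum_congr rfl fun b _ => ?_
  rw [← Finset.sum_mul]
  simp

/-- The operator acting by `E` on the tensor positions `p`, `q` and by `M j` on every other
position `j`. -/
def pairKron (p q : Fin r) (E : Matrix (Fin N × Fin N) (Fin N × Fin N) R)
    (M : Fin r → Matrix (Fin N) (Fin N) R) : Matrix (Fin r → Fin N) (Fin r → Fin N) R :=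
  fun a b => E (a p, a q) (b p, b q) * ∏ j ∈ Finset.univ \ {p, q}, M j (a j) (b j)

theorem pairKron_mul {p q : Fin r} (hpq : p ≠ q)
    (E E' : Matrix (Fin N × Fin N) (Fin N × Fin N) R) (M M' : Fin r → Matrix (Fin N) (Fin N) R) :
    pairKron p q E M * pairKron p q E' M' = pairKron p q (E * E') fun j => M j * M' j := by
  ext a c
  simp only [pairKron, Matrix.mul_apply]
  rw [← sum_mul_prod_sdiff_pair hpq (fun x => E (a p, a q) x * E' x (c p, c q))
    fun j y => M j (a j) y * M' j y (c j)]
  refine Finset.sum_congr rfl fun b _ => ?_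
  rw [Finset.prod_mul_distrib]
  ring

theorem pairKron_add (p q : Fin r) (E E' : Matrix (Fin N × Fin N) (Fin N × Fin N) R)
    (M : Fin r → Matrix (Fin N) (Fin N) R) :
    pairKron p q (E + E') M = pairKron p q E M + pairKron p q E' M := by
  ext a c
  simp [pairKron, add_mul]

theorem pairKron_congr {p q : Fin r} {E E' : Matrix (Fin N × Fin N) (Fin N × Fin N) R}
    {M M' : Fin r → Matrix (Fin N) (Fin N) R} (hE : E = E')
    (hM : ∀ j, j ≠ p → j ≠ q → M j = M' j) : pairKron p q E M = pairKron p q E' M' := by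
  ext a c
  subst hE
  simp only [pairKron]
  congr 1
  refine Finset.prod_congr rfl fun j hj => ?_
  simp only [Finset.mem_sdiff, Finset.mem_insert, Finset.mem_singleton, not_or] at hj
  rw [hM j hj.2.1 hj.2.2]

theorem kron_eq_pairKron {p q : Fin r} (hpq : p ≠ q) (M : Fin r → Matrix (Fin N) (Fin N) R) :
    kron M = pairKron p q (M p ⊗ₖ M q) M := by
  ext a c
  simp only [kron, pairKron, Matrix.kroneckerMap_apply]
  rw [prod_eq_mul_mul_prod_sdiff_pair hpq]

theorem twoSiteOp_eq_pairKron (E : Fin N × Fin N → Fin N × Fin N → R) {i : ℕ} (h : i + 1 < r) :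
    twoSiteOp E r i h = pairKron ⟨i, Nat.lt_of_succ_lt h⟩ ⟨i + 1, h⟩ (Matrix.of E) 1 := by
  ext a c
  simp [twoSiteOp, pairKron, Matrix.one_apply]

theorem fin_mk_ne_mk_succ {i : ℕ} (h : i + 1 < r) :
    (⟨i, Nat.lt_of_succ_lt h⟩ : Fin r) ≠ ⟨i + 1, h⟩ := by
  simp

theorem commute_twoSiteOp_kron {E : Fin N × Fin N → Fin N × Fin N → R} {i : ℕ} (h : i + 1 < r)
    (M : Fin r → Matrix (Fin N) (Fin N) R)
    (hE : Commute (Matrix.of E) (M ⟨i, Nat.lt_of_succ_lt h⟩ ⊗ₖ M ⟨i + 1, h⟩)) :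
    Commute (twoSiteOp E r i h) (kron M) := by
  have hne := fin_mk_ne_mk_succ h
  rw [commute_iff_eq, twoSiteOp_eq_pairKron, kron_eq_pairKron hne, pairKron_mul hne,
    pairKron_mul hne]
  exact pairKron_congr hE fun j _ _ => by simp

theorem commute_twoSiteOp_sum_kron {E : Fin N × Fin N → Fin N × Fin N → R} {i : ℕ}
    (h : i + 1 < r) (A B C : Matrix (Fin N) (Fin N) R)
    (hA : Commute (Matrix.of E) (A ⊗ₖ A)) (hC : Commute (Matrix.of E) (C ⊗ₖ C))
    (hB : Commute (Matrix.of E) (B ⊗ₖ C + A ⊗ₖ B)) :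
    Commute (twoSiteOp E r i h)
      (∑ p : Fin r, kron fun j => if j < p then A else if j = p then B else C) := by
  have hne := fin_mk_ne_mk_succ h
  rw [← Finset.sum_sdiff (Finset.subset_univ {⟨i, Nat.lt_of_succ_lt h⟩, ⟨i + 1, h⟩})]
  refine Commute.add_right (Commute.sum_right _ _ _ fun p hp => ?_) ?_
  · simp only [Finset.mem_sdiff, Finset.mem_insert, Finset.mem_singleton, not_or, Fin.ext_iff] at hp
    apply commute_twoSiteOp_kron
    obtain ⟨-, h1, h2⟩ := hp
    simp only [Fin.lt_def, Fin.ext_iff]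
    rcases lt_or_gt_of_ne h1 with h3 | h3
    · rwa [if_neg (by omega), if_neg (by omega), if_neg (by omega), if_neg (by omega)]
    · rwa [if_pos (by omega), if_pos (by omega)]
  · rw [Finset.sum_pair hne, kron_eq_pairKron hne, kron_eq_pairKron hne, commute_iff_eq,
      twoSiteOp_eq_pairKron]
    have h1 : pairKron (R := R) ⟨i, Nat.lt_of_succ_lt h⟩ ⟨i + 1, h⟩ (A ⊗ₖ B)
        (fun j : Fin r => if j < ⟨i + 1, h⟩ then A else if j = ⟨i + 1, h⟩ then B else C) =
        pairKron ⟨i, Nat.lt_of_succ_lt h⟩ ⟨i + 1, h⟩ (A ⊗ₖ B) fun j =>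
          if j < ⟨i, Nat.lt_of_succ_lt h⟩ then A
            else if j = ⟨i, Nat.lt_of_succ_lt h⟩ then B else C := by
      refine pairKron_congr rfl fun j hj hj' => ?_
      simp only [Fin.lt_def, Fin.ext_iff, ne_eq] at hj hj' ⊢
      by_cases h2 : (j : ℕ) < i
      · rw [if_pos (by omega), if_pos h2]
      · rw [if_neg (by omega), if_neg (by omega), if_neg (by omega), if_neg (by omega)]
    simp only [lt_irrefl, if_false, if_true, Fin.lt_def, Nat.lt_succ_self, Fin.ext_iff,
      Nat.succ_ne_self, not_lt_of_gt, hne] at h1 ⊢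
    rw [h1, ← pairKron_add, pairKron_mul hne,
      pairKron_mul hne]
    exact pairKron_congr hB fun j _ _ => by simp

end TensorOperators

section HeckeTwoSite

variable {R : Type*} [CommRing R] {N : ℕ}

theorem Smat_eq_diagonal (m : ℕ) :
    (Smat R m : Matrix (Fin N) (Fin N) R) = Matrix.diagonal fun a => (-1 : R) ^ deg m a := rfl

theorem Qmat_eq_diagonal (x : R) (b : Fin N) :
    Qmat x b = Matrix.diagonal fun a => if a = b then x else 1 := rfl

theorem Dmat_eq_diagonal (x xinv : R) (m k : ℕ) :
    (Dmat x xinv m k : Matrix (Fin N) (Fin N) R) = Matrix.diagonal fun a : Fin N =>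
      if (a : ℕ) = k then (if k < m then x else xinv)
      else if (a : ℕ) = k + 1 then (if k + 1 < m then xinv else x) else 1 := rfl

theorem SPmat_eq_diagonal (m k : ℕ) :
    (SPmat R m k : Matrix (Fin N) (Fin N) R) = Matrix.diagonal fun a =>
      if k + 1 = m then (-1 : R) ^ deg m a else 1 := by
  by_cases h : k + 1 = m
  · simp [SPmat, h, Smat_eq_diagonal]
  · simp [SPmat, h]

theorem sgn_comm (m : ℕ) (k l : Fin N) : sgn R m k l = sgn R m l k := by
  rw [sgn, sgn, mul_comm]

theorem Tent_symm (x xinv : R) (m : ℕ) (p p' : Fin N × Fin N) :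
    Tent x xinv m p p' = Tent x xinv m p' p := by
  by_cases h : p' = p
  · rw [h]
  by_cases h' : p' = (p.2, p.1)
  · subst h'
    obtain ⟨a, b⟩ := p
    have hab : a ≠ b := fun hab => h (by rw [hab])
    rcases lt_or_gt_of_ne (Fin.val_ne_of_ne hab) with hlt | hlt <;>
    simp [Tent, hab, hab.symm, hlt, hlt.not_gt, sgn_comm m a b]
  · have h'' : p ≠ (p'.2, p'.1) := fun e => h' (by rw [e])
    simp [Tent, h, h', h'', Ne.symm h]

/-- The two-site Hecke operator as a matrix. -/
def tentMatrix (x xinv : R) (m N : ℕ) : Matrix (Fin N × Fin N) (Fin N × Fin N) R :=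
  Matrix.of (Tent x xinv m)

theorem tentMatrix_mul_apply (x xinv : R) (m : ℕ)
    (Z : Matrix (Fin N × Fin N) (Fin N × Fin N) R) (a b : Fin N) (s : Fin N × Fin N) :
    (tentMatrix x xinv m N * Z) (a, b) s =
      if a = b then (if (a : ℕ) < m then x else -xinv) * Z (a, b) s
      else if (a : ℕ) < (b : ℕ) then sgn R m a b * Z (b, a) s + (x - xinv) * Z (a, b) s
      else sgn R m a b * Z (b, a) s := by
  simp only [tentMatrix, Matrix.mul_apply, Matrix.of_apply, Tent]
  split_ifs <;> simp [add_mul, Finset.sum_add_distrib]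

theorem mul_tentMatrix_apply (x xinv : R) (m : ℕ)
    (Z : Matrix (Fin N × Fin N) (Fin N × Fin N) R) (p : Fin N × Fin N) (a b : Fin N) :
    (Z * tentMatrix x xinv m N) p (a, b) =
      if a = b then (if (a : ℕ) < m then x else -xinv) * Z p (a, b)
      else if (a : ℕ) < (b : ℕ) then sgn R m a b * Z p (b, a) + (x - xinv) * Z p (a, b)
      else sgn R m a b * Z p (b, a) := by
  have h : (tentMatrix x xinv m N).transpose = tentMatrix x xinv m N := by
    ext u v
    exact Tent_symm x xinv m v u
  rw [← Matrix.transpose_apply (Z * _), Matrix.transpose_mul, h, tentMatrix_mul_apply]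
  rfl

theorem commute_tentMatrix_diagonal (x xinv : R) (m : ℕ) (f : Fin N → R) :
    Commute (tentMatrix x xinv m N) (Matrix.diagonal f ⊗ₖ Matrix.diagonal f) := by
  rw [commute_iff_eq]
  ext ⟨a, b⟩ ⟨c, e⟩
  rw [tentMatrix_mul_apply, mul_tentMatrix_apply]
  simp only [Matrix.kroneckerMap_apply, Matrix.diagonal_apply]
  by_cases h : a = c ∧ b = e
  · obtain ⟨rfl, rfl⟩ := h
    by_cases hab : a = b
    · subst hab
      simp
    · simp [hab, Ne.symm hab]
  by_cases h' : b = c ∧ a = e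
  · obtain ⟨rfl, rfl⟩ := h'
    have hab : a ≠ b := fun e => h ⟨e, e.symm⟩
    rcases lt_or_gt_of_ne (Fin.val_ne_of_ne hab) with hlt | hlt <;>
    simp [hab, hab.symm, sgn_comm m a b, hlt, hlt.not_gt, mul_comm]
  have z : ∀ u v : R, (if a = c then u else 0) * (if b = e then v else 0) = 0 := by
    intro u v
    rw [ite_zero_mul_ite_zero, if_neg h]
  have z' : ∀ u v : R, (if b = c then u else 0) * (if a = e then v else 0) = 0 := by
    intro u v
    rw [ite_zero_mul_ite_zero, if_neg h']
  have z'' : ∀ u v : R, (if a = e then u else 0) * (if b = c then v else 0) = 0 := by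
    intro u v
    rw [mul_comm, z']
  simp [z, z', z'']

theorem commute_tentMatrix_Emat {x xinv : R} (hx : x * xinv = 1) (m k : ℕ) :
    Commute (tentMatrix x xinv m N) (Emat R (N := N) k ⊗ₖ Dinvmat x xinv m k +
      SPmat R m k ⊗ₖ Emat R k) := by
  rw [commute_iff_eq, Dinvmat, Dmat_eq_diagonal, SPmat_eq_diagonal]
  ext ⟨a, b⟩ ⟨c, e⟩
  rw [tentMatrix_mul_apply, mul_tentMatrix_apply]
  simp only [Matrix.add_apply, Matrix.kroneckerMap_apply, Matrix.diagonal_apply, Emat, sgn, deg,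
    Fin.ext_iff]
  generalize (a : ℕ) = a, (b : ℕ) = b, (c : ℕ) = c, (e : ℕ) = e
  by_cases ha : a = k + 1 <;> by_cases hb : b = k + 1 <;> by_cases hc : c = k <;>
    by_cases he : e = k <;> simp only [ha, hb, hc, he, and_true, if_true, if_false, and_false,
      mul_zero, zero_mul, mul_one, one_mul, add_zero, zero_add, ite_self, lt_irrefl]
  all_goals
    rcases lt_trichotomy (k + 1) m with hm | hm | hm
    · have h : k < m := by omega
      simp only [hm, h, hm.ne, if_true, if_false] <;> split_ifs <;> first
        | (exfalso; omega) | ring1 | (simp; done) | linear_combination hx | linear_combination -hx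
    · have h : k < m := by omega
      simp only [hm, h, if_true] <;> split_ifs <;> first
        | (exfalso; omega) | ring1 | (simp; done) | linear_combination hx | linear_combination -hx
    · have h : ¬k < m := by omega
      have h' : ¬k + 1 < m := by omega
      simp only [h, h', hm.ne', if_false] <;> split_ifs <;> first
        | (exfalso; omega) | ring1 | (simp; done) | linear_combination hx | linear_combination -hx

theorem commute_tentMatrix_Fmat {x xinv : R} (hx : x * xinv = 1) (m k : ℕ) :
    Commute (tentMatrix x xinv m N) (Fmat R (N := N) k ⊗ₖ 1 +
      (SPmat R m k * Dmat x xinv m k) ⊗ₖ Fmat R k) := by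
  rw [commute_iff_eq, Dmat_eq_diagonal, SPmat_eq_diagonal, Matrix.diagonal_mul_diagonal,
    ← Matrix.diagonal_one]
  ext ⟨a, b⟩ ⟨c, e⟩
  rw [tentMatrix_mul_apply, mul_tentMatrix_apply]
  simp only [Matrix.add_apply, Matrix.kroneckerMap_apply, Matrix.diagonal_apply, Fmat, sgn, deg,
    Fin.ext_iff]
  generalize (a : ℕ) = a, (b : ℕ) = b, (c : ℕ) = c, (e : ℕ) = e
  by_cases ha : a = k <;> by_cases hb : b = k <;> by_cases hc : c = k + 1 <;>
    by_cases he : e = k + 1 <;> simp only [ha, hb, hc, he, and_true, if_true, if_false, and_false,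
      mul_zero, zero_mul, mul_one, one_mul, add_zero, zero_add, ite_self, lt_irrefl]
  all_goals
    rcases lt_trichotomy (k + 1) m with hm | hm | hm
    · have h : k < m := by omega
      simp only [hm, h, hm.ne, if_true, if_false] <;> split_ifs <;> first
        | (exfalso; omega) | ring1 | (simp; done) | linear_combination hx | linear_combination -hx
    · have h : k < m := by omega
      simp only [hm, h, if_true] <;> split_ifs <;> first
        | (exfalso; omega) | ring1 | (simp; done) | linear_combination hx | linear_combination -hx
    · have h : ¬k < m := by omega
      have h' : ¬k + 1 < m := by omega
      simp only [h, h', hm.ne', if_false] <;> split_ifs <;> first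
        | (exfalso; omega) | ring1 | (simp; done) | linear_combination hx | linear_combination -hx

variable {r i : ℕ}

theorem commute_heckeOp_rhoSigma (x xinv : R) (m : ℕ) (h : i + 1 < r) :
    Commute (heckeOp x xinv m r i h) (rhoSigma R m (N := N) r) :=
  commute_twoSiteOp_kron h _ (commute_tentMatrix_diagonal x xinv m _)

theorem commute_heckeOp_rhoQ (x xinv y : R) (m : ℕ) (h : i + 1 < r) (b : Fin N) :
    Commute (heckeOp x xinv m r i h) (rhoQ y r b) :=
  commute_twoSiteOp_kron h _ (commute_tentMatrix_diagonal x xinv m _)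

theorem commute_heckeOp_rhoE {x xinv : R} (hx : x * xinv = 1) (m k : ℕ) (h : i + 1 < r) :
    Commute (heckeOp x xinv m r i h) (rhoE x xinv m (N := N) r k) := by
  refine commute_twoSiteOp_sum_kron h _ _ _ ?_ ?_ (commute_tentMatrix_Emat hx m k)
  · rw [SPmat_eq_diagonal]
    exact commute_tentMatrix_diagonal x xinv m _
  · exact commute_tentMatrix_diagonal x xinv m _

theorem commute_heckeOp_rhoF {x xinv : R} (hx : x * xinv = 1) (m k : ℕ) (h : i + 1 < r) :
    Commute (heckeOp x xinv m r i h) (rhoF x xinv m (N := N) r k) := by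
  refine commute_twoSiteOp_sum_kron h _ _ _ ?_ ?_ (commute_tentMatrix_Fmat hx m k)
  · rw [SPmat_eq_diagonal, Dmat_eq_diagonal, Matrix.diagonal_mul_diagonal]
    exact commute_tentMatrix_diagonal x xinv m _
  · rw [← Matrix.diagonal_one]
    exact commute_tentMatrix_diagonal x xinv m _

theorem commute_heckeOp_of_mem_quantumGens {x xinv : R} (hx : x * xinv = 1) (m : ℕ)
    (h : i + 1 < r) {M : Matrix (Fin r → Fin N) (Fin r → Fin N) R}
    (hM : M ∈ quantumGens x xinv m r) : Commute (heckeOp x xinv m r i h) M := by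
  simp only [quantumGens, Set.mem_union, Set.mem_singleton_iff, Set.mem_range] at hM
  rcases hM with (((rfl | ⟨b, rfl⟩) | ⟨b, rfl⟩) | ⟨k, rfl⟩) | ⟨k, rfl⟩
  · exact commute_heckeOp_rhoSigma x xinv m h
  · exact commute_heckeOp_rhoQ x xinv x m h b
  · exact commute_heckeOp_rhoQ x xinv xinv m h b
  · exact commute_heckeOp_rhoE hx m k h
  · exact commute_heckeOp_rhoF hx m k h

end HeckeTwoSite

section GradedUnits

variable {R A ι α : Type*} [CommRing R] [Ring A] [Algebra R A] [Fintype ι]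
  {X : ι → α → α → A} {d : α → ℕ}

theorem sum_unit_eq_supercommutator [DecidableEq α]
    (hmul : ∀ i a b c e, X i a b * X i c e = if b = c then X i a e else 0)
    (hcomm : ∀ i j, i ≠ j → ∀ a b c e, X i a b * X j c e =
      (-1 : R) ^ ((d a + d b) * (d c + d e)) • (X j c e * X i a b))
    {a e : α} (hae : a ≠ e) (c : α) :
    ∑ j, X j a e = (∑ j, X j a c) * (∑ j, X j c e) -
      (-1 : R) ^ ((d a + d c) * (d c + d e)) • ((∑ j, X j c e) * ∑ j, X j a c) := by
  rw [Finset.sum_mul_sum, Finset.sum_mul_sum, Finset.sum_comm (s := Finset.univ) (t := Finset.univ)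
    (f := fun i j => X i c e * X j a c)]
  simp only [Finset.smul_sum, ← Finset.sum_sub_distrib]
  refine Finset.sum_congr rfl fun i _ => ?_
  rw [Finset.sum_eq_single i]
  · simp [hmul, hae.symm]
  · intro j _ hj
    rw [hcomm i j hj.symm, sub_self]
  · simp

theorem sum_unit_mem {N : ℕ} {X : ι → Fin N → Fin N → A} {d : Fin N → ℕ}
    (hmul : ∀ i a b c e, X i a b * X i c e = if b = c then X i a e else 0)
    (hcomm : ∀ i j, i ≠ j → ∀ a b c e, X i a b * X j c e =
      (-1 : R) ^ ((d a + d b) * (d c + d e)) • (X j c e * X i a b))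
    (G : Subalgebra R A) (hdiag : ∀ b, ∑ j, X j b b ∈ G)
    (hup : ∀ a b : Fin N, (a : ℕ) + 1 = b → ∑ j, X j a b ∈ G)
    (hdown : ∀ a b : Fin N, (a : ℕ) + 1 = b → ∑ j, X j b a ∈ G) (a b : Fin N) :
    ∑ j, X j a b ∈ G := by
  have key : ∀ n : ℕ, ∀ a b : Fin N, (a : ℕ) + n + 1 = b →
      ∑ j, X j a b ∈ G ∧ ∑ j, X j b a ∈ G := by
    intro n
    induction n with
    | zero => exact fun a b h => ⟨hup a b h, hdown a b h⟩
    | succ n ih =>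
      intro a b h
      have hb := b.isLt
      obtain ⟨h1, h2⟩ := ih a ⟨a + n + 1, by omega⟩ rfl
      have h3 : (a : ℕ) + n + 1 + 1 = b := by omega
      have hab : a ≠ b := by
        rintro rfl
        omega
      rw [sum_unit_eq_supercommutator hmul hcomm hab ⟨a + n + 1, by omega⟩,
        sum_unit_eq_supercommutator hmul hcomm hab.symm ⟨a + n + 1, by omega⟩]
      have h4 := hup ⟨a + n + 1, by omega⟩ b h3
      have h5 := hdown ⟨a + n + 1, by omega⟩ b h3
      exact ⟨G.sub_mem (G.mul_mem h1 h4) (G.smul_mem (G.mul_mem h4 h1) _),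
        G.sub_mem (G.mul_mem h5 h2) (G.smul_mem (G.mul_mem h2 h5) _)⟩
  rcases lt_trichotomy (a : ℕ) b with h | h | h
  · exact (key (b - a - 1) a b (by omega)).1
  · rw [Fin.ext h]
    exact hdiag b
  · exact (key (a - b - 1) b a (by omega)).2

theorem mul_prod_ofFn_of_intertwine {M : Type*} [Monoid M] {s : ℕ} (U : M) (f f' : Fin s → M)
    (h : ∀ i, U * f i = f' i * U) :
    U * (List.ofFn f).prod = (List.ofFn f').prod * U := by
  induction s with
  | zero => simp
  | succ s ih =>
    rw [List.ofFn_succ, List.ofFn_succ, List.prod_cons, List.prod_cons, ← mul_assoc, h, mul_assoc,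
      ih _ _ fun i => h i.succ, mul_assoc]

theorem exists_intertwiner {n : ℕ} {X : Fin (n + 1) → α → α → A} (S : Subalgebra R A)
    (hS : ∀ i : Fin n, ∃ P ∈ S, P * P = 1 ∧ ∀ j a b,
      P * X j a b = X (Equiv.swap i.castSucc i.succ j) a b * P) (g : Equiv.Perm (Fin (n + 1))) :
    ∃ U ∈ S, ∃ U' ∈ S, U * U' = 1 ∧ ∀ j a b, U * X j a b = X (g j) a b * U := by
  have hg : g ∈ Submonoid.closure (Set.range fun i : Fin n => Equiv.swap i.castSucc i.succ) := by
    rw [Equiv.Perm.mclosure_swap_castSucc_succ]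
    trivial
  induction hg using Submonoid.closure_induction with
  | mem g hg =>
    obtain ⟨i, rfl⟩ := hg
    obtain ⟨P, hP, hPP, h⟩ := hS i
    exact ⟨P, hP, P, hP, hPP, h⟩
  | one => exact ⟨1, S.one_mem, 1, S.one_mem, one_mul 1, fun j a b => by simp⟩
  | mul g g' _ _ ih ih' =>
    obtain ⟨U, hU, V, hV, hUV, h⟩ := ih
    obtain ⟨U', hU', V', hV', hUV', h'⟩ := ih'
    refine ⟨U * U', S.mul_mem hU hU', V' * V, S.mul_mem hV' hV, ?_, fun j a b => ?_⟩
    · rw [mul_assoc, ← mul_assoc U', hUV', one_mul, hUV]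
    · rw [mul_assoc, h', ← mul_assoc, h, mul_assoc, Equiv.Perm.mul_apply]

end GradedUnits

section SuperUnits

variable {R : Type*} [CommRing R] {N r : ℕ}

/-- The matrix unit `single a b 1` of the tensor position `j`, preceded by the signs of the
super tensor product. -/
def superUnit (R : Type*) [CommRing R] (m : ℕ) (j : Fin r) (a b : Fin N) :
    Matrix (Fin r → Fin N) (Fin r → Fin N) R :=
  kron fun l => if l < j then Smat R m ^ (deg m a + deg m b)
    else if l = j then Matrix.single a b 1 else 1

theorem Smat_pow (m u : ℕ) :
    (Smat R m : Matrix (Fin N) (Fin N) R) ^ u =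
      Matrix.diagonal fun a => (-1 : R) ^ (deg m a * u) := by
  rw [Smat_eq_diagonal, Matrix.diagonal_pow]
  congr 1
  funext a
  simp [pow_mul]

theorem Smat_mul_self (m : ℕ) : (Smat R m * Smat R m : Matrix (Fin N) (Fin N) R) = 1 := by
  rw [← pow_two, Smat_pow, ← Matrix.diagonal_one]
  congr 1
  funext a
  rw [mul_comm, pow_mul, neg_one_sq, one_pow]

theorem single_mul_Smat_pow (m u : ℕ) (a b : Fin N) :
    Matrix.single a b (1 : R) * Smat R m ^ u = (-1 : R) ^ (deg m b * u) • Matrix.single a b 1 := by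
  rw [Smat_pow]
  ext c e
  by_cases h : b = e
  · subst h
    simp [Matrix.mul_diagonal, mul_comm]
  · simp [Matrix.mul_diagonal, h]

theorem Smat_pow_mul_single (m u : ℕ) (a b : Fin N) :
    Smat R m ^ u * Matrix.single a b (1 : R) = (-1 : R) ^ (deg m a * u) • Matrix.single a b 1 := by
  rw [Smat_pow]
  ext c e
  by_cases h : a = c
  · subst h
    simp [Matrix.diagonal_mul]
  · simp [Matrix.diagonal_mul, h]

theorem single_mul_Smat_pow_eq_smul (m u : ℕ) (a b : Fin N) :
    Matrix.single a b (1 : R) * Smat R m ^ u =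
      (-1 : R) ^ ((deg m a + deg m b) * u) • (Smat R m ^ u * Matrix.single a b 1) := by
  rw [single_mul_Smat_pow, Smat_pow_mul_single, smul_smul, ← pow_add, add_mul, add_right_comm,
    pow_add, ← two_mul, pow_mul _ 2, neg_one_sq, one_pow, one_mul]

theorem superUnit_mul_superUnit_same (m : ℕ) (j : Fin r) (a b c e : Fin N) :
    superUnit R m j a b * superUnit R m j c e = if b = c then superUnit R m j a e else 0 := by
  rw [superUnit, superUnit, kron_mul]
  split_ifs with h
  · subst h
    rw [superUnit]
    congr 1
    funext l
    split_ifs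
    · rw [← pow_add, show deg m a + deg m b + (deg m b + deg m e) =
        2 * deg m b + (deg m a + deg m e) by ring, pow_add, pow_mul, pow_two, Smat_mul_self,
        one_pow, one_mul]
    · simp
    · simp
  · exact kron_eq_zero j (by simp [h])

theorem kron_mul_eq_smul {M M' : Fin r → Matrix (Fin N) (Fin N) R} (i : Fin r) (c : R)
    (hi : M i * M' i = c • (M' i * M i)) (h : ∀ l, l ≠ i → M l * M' l = M' l * M l) :
    kron M * kron M' = c • (kron M' * kron M) := by
  have hc : ∏ l, (if l = i then c else 1) = c := by simp
  rw [kron_mul, kron_mul]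
  conv_rhs => rw [← hc]
  rw [← kron_smul]
  congr 1
  funext l
  by_cases hl : l = i
  · subst hl
    rw [if_pos rfl, hi]
  · rw [if_neg hl, one_smul, h l hl]

theorem superUnit_mul_superUnit_of_lt (m : ℕ) {i j : Fin r} (hij : i < j) (a b c e : Fin N) :
    superUnit R m i a b * superUnit R m j c e =
      (-1 : R) ^ ((deg m a + deg m b) * (deg m c + deg m e)) •
        (superUnit R m j c e * superUnit R m i a b) := by
  refine kron_mul_eq_smul i _ ?_ fun l hl => ?_
  · simp only [lt_irrefl, if_false, if_true, hij]
    exact single_mul_Smat_pow_eq_smul m _ a b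
  · by_cases h : l < i
    · simp only [h, h.trans hij, if_true]
      rw [← pow_add, ← pow_add, add_comm]
    · simp [h, hl]

theorem superUnit_mul_superUnit_of_ne (m : ℕ) {i j : Fin r} (hij : i ≠ j) (a b c e : Fin N) :
    superUnit R m i a b * superUnit R m j c e =
      (-1 : R) ^ ((deg m a + deg m b) * (deg m c + deg m e)) •
        (superUnit R m j c e * superUnit R m i a b) := by
  rcases lt_or_gt_of_ne hij with h | h
  · exact superUnit_mul_superUnit_of_lt m h a b c e
  · rw [superUnit_mul_superUnit_of_lt m h c e a b, smul_smul, mul_comm (deg m c + _), ← pow_add,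
      ← two_mul, pow_mul, neg_one_sq, one_pow, one_smul]

theorem exists_single_eq_smul_prod (m : ℕ) (a b : Fin N) {s : ℕ} (l : Fin s)
    (M : Fin s → Matrix (Fin N) (Fin N) R) (u : Fin s → ℕ) (hlt : ∀ i, i < l → M i = 1)
    (hl : M l = Matrix.single a b 1) (hgt : ∀ i, l < i → M i = Smat R m ^ u i) :
    ∃ c : R, Matrix.single a b (1 : R) = c • (List.ofFn M).prod := by
  induction s with
  | zero => exact l.elim0
  | succ s ih =>
    rw [List.ofFn_succ_last, List.prod_append, List.prod_singleton]
    induction l using Fin.lastCases with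
    | last =>
      refine ⟨1, ?_⟩
      have h : (fun i : Fin s => M i.castSucc) = fun _ => 1 :=
        funext fun i => hlt _ (Fin.castSucc_lt_last i)
      rw [h, hl, List.ofFn_const, List.prod_replicate, one_pow, one_mul, one_smul]
    | cast l =>
      obtain ⟨c, hc⟩ := ih l (fun i => M i.castSucc) (fun i => u i.castSucc)
        (fun i hi => hlt _ (Fin.castSucc_lt_castSucc_iff.2 hi)) hl
        (fun i hi => hgt _ (Fin.castSucc_lt_castSucc_iff.2 hi))
      refine ⟨(-1) ^ (deg m b * u (Fin.last s)) * c, ?_⟩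
      rw [hgt _ (Fin.castSucc_lt_last l), mul_smul, ← smul_mul_assoc, ← hc, single_mul_Smat_pow,
        smul_smul, ← pow_add, ← two_mul, pow_mul, neg_one_sq, one_pow, one_smul]

theorem prod_ofFn_kron {s : ℕ} (M : Fin s → Fin r → Matrix (Fin N) (Fin N) R) :
    (List.ofFn fun i => kron (M i)).prod = kron fun l => (List.ofFn fun i => M i l).prod := by
  induction s with
  | zero => simp [kron_one]
  | succ s ih => simp only [List.ofFn_succ, List.prod_cons, ih, kron_mul]

theorem exists_single_eq_smul_prod_superUnit (m : ℕ) (a b : Fin r → Fin N) :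
    ∃ c : R, Matrix.single a b (1 : R) =
      c • (List.ofFn fun i => superUnit R m i (a i) (b i)).prod := by
  choose c hc using fun l : Fin r => exists_single_eq_smul_prod (R := R) m (a l) (b l) l
    (fun i => if l < i then Smat R m ^ (deg m (a i) + deg m (b i))
      else if l = i then Matrix.single (a i) (b i) 1 else 1)
    (fun i => deg m (a i) + deg m (b i)) (fun i hi => by simp [hi.not_gt, hi.ne'])
    (by simp) (fun i hi => by simp [hi])
  refine ⟨∏ l, c l, ?_⟩
  simp only [superUnit]
  rw [prod_ofFn_kron, ← kron_smul, ← kron_single]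
  congr 1
  funext l
  exact hc l

end SuperUnits

section Swap

variable {R : Type*} [CommRing R] {N r : ℕ}

theorem tentMatrix_one_mul_apply (m : ℕ) (Z : Matrix (Fin N × Fin N) (Fin N × Fin N) R)
    (a b : Fin N) (s : Fin N × Fin N) :
    (tentMatrix (1 : R) 1 m N * Z) (a, b) s = sgn R m a b * Z (b, a) s := by
  rw [tentMatrix_mul_apply]
  by_cases h : a = b
  · subst h
    simp only [if_true, sgn, deg]
    split_ifs <;> simp
  · simp [h]

theorem mul_tentMatrix_one_apply (m : ℕ) (Z : Matrix (Fin N × Fin N) (Fin N × Fin N) R)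
    (p : Fin N × Fin N) (a b : Fin N) :
    (Z * tentMatrix (1 : R) 1 m N) p (a, b) = sgn R m a b * Z p (b, a) := by
  rw [mul_tentMatrix_apply]
  by_cases h : a = b
  · subst h
    simp only [if_true, sgn, deg]
    split_ifs <;> simp
  · simp [h]

theorem sgn_mul_self (m : ℕ) (a b : Fin N) : sgn R m a b * sgn R m a b = 1 := by
  rw [sgn, ← pow_add, ← two_mul, pow_mul, neg_one_sq, one_pow]

theorem tentMatrix_one_mul_self (m : ℕ) :
    tentMatrix (1 : R) 1 m N * tentMatrix (1 : R) 1 m N = 1 := by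
  ext ⟨a, b⟩ ⟨c, e⟩
  rw [← Matrix.mul_one (tentMatrix (1 : R) 1 m N * tentMatrix (1 : R) 1 m N), mul_assoc,
    tentMatrix_one_mul_apply, tentMatrix_one_mul_apply, sgn_comm m b a, ← mul_assoc, sgn_mul_self,
    one_mul]

theorem tentMatrix_one_mul_single_kronecker (m : ℕ) (a b : Fin N) :
    tentMatrix (1 : R) 1 m N * (Matrix.single a b (1 : R) ⊗ₖ 1) =
      ((Smat R m ^ (deg m a + deg m b)) ⊗ₖ Matrix.single a b 1) * tentMatrix (1 : R) 1 m N := by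
  ext ⟨c, e⟩ ⟨f, g⟩
  rw [tentMatrix_one_mul_apply, mul_tentMatrix_one_apply, Smat_pow]
  simp only [Matrix.kroneckerMap_apply, Matrix.diagonal_apply, Matrix.one_apply,
    Matrix.single_apply]
  by_cases h : c = g
  · subst h
    by_cases h' : a = e ∧ b = f
    · obtain ⟨rfl, rfl⟩ := h'
      simp only [sgn, if_true, and_self, mul_one]
      rw [← pow_add, mul_add, add_left_comm, mul_comm (deg m b), ← two_mul, pow_add, pow_mul _ 2,
        neg_one_sq, one_pow, mul_one]
    · simp [h']
  · simp [h]

theorem tentMatrix_one_mul_kronecker_single (m : ℕ) (a b : Fin N) :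
    tentMatrix (1 : R) 1 m N * ((Smat R m ^ (deg m a + deg m b)) ⊗ₖ Matrix.single a b 1) =
      (Matrix.single a b (1 : R) ⊗ₖ 1) * tentMatrix (1 : R) 1 m N := by
  have h := congrArg (fun Z => tentMatrix (1 : R) 1 m N * Z * tentMatrix (1 : R) 1 m N)
    (tentMatrix_one_mul_single_kronecker (R := R) m a b)
  simp only [mul_assoc, tentMatrix_one_mul_self, mul_one] at h
  rw [← h, ← mul_assoc, tentMatrix_one_mul_self, one_mul]

theorem twoSiteOp_mul_kron {E : Fin N × Fin N → Fin N × Fin N → R} {i : ℕ} (h : i + 1 < r)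
    (M M' : Fin r → Matrix (Fin N) (Fin N) R)
    (hE : Matrix.of E * (M ⟨i, Nat.lt_of_succ_lt h⟩ ⊗ₖ M ⟨i + 1, h⟩) =
      (M' ⟨i, Nat.lt_of_succ_lt h⟩ ⊗ₖ M' ⟨i + 1, h⟩) * Matrix.of E)
    (hM : ∀ j : Fin r, (j : ℕ) ≠ i → (j : ℕ) ≠ i + 1 → M j = M' j) :
    twoSiteOp E r i h * kron M = kron M' * twoSiteOp E r i h := by
  have hne := fin_mk_ne_mk_succ h
  rw [twoSiteOp_eq_pairKron, kron_eq_pairKron hne, kron_eq_pairKron hne, pairKron_mul hne,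
    pairKron_mul hne]
  refine pairKron_congr hE fun j hj hj' => ?_
  simp [hM j (fun e => hj (Fin.ext e)) fun e => hj' (Fin.ext e)]

theorem heckeOp_one_mul_self (m : ℕ) {i : ℕ} (h : i + 1 < r) :
    heckeOp 1 1 m (N := N) r i h * heckeOp 1 1 m r i h = (1 : Matrix _ _ R) := by
  have hne := fin_mk_ne_mk_succ h
  have h1 : Matrix.of (Tent 1 1 m) * Matrix.of (Tent 1 1 m) =
      (1 : Matrix (Fin N × Fin N) (Fin N × Fin N) R) := tentMatrix_one_mul_self m
  rw [heckeOp, twoSiteOp_eq_pairKron, pairKron_mul hne, h1, ← kron_one, kron_eq_pairKron hne]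
  exact pairKron_congr (Matrix.one_kronecker_one).symm fun j _ _ => by simp

theorem heckeOp_one_mul_superUnit (m : ℕ) {n : ℕ} (i : Fin n) (j : Fin (n + 1)) (a b : Fin N) :
    heckeOp 1 1 m (n + 1) i (Nat.succ_lt_succ i.isLt) * superUnit R m j a b =
      superUnit R m (Equiv.swap i.castSucc i.succ j) a b *
        heckeOp 1 1 m (n + 1) i (Nat.succ_lt_succ i.isLt) := by
  obtain ⟨i, hi⟩ := i
  refine twoSiteOp_mul_kron _ _ _ ?_ fun l hl hl' => ?_
  · by_cases h : j = Fin.castSucc ⟨i, hi⟩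
    · subst h
      rw [Equiv.swap_apply_left]
      simpa [tentMatrix, Fin.lt_def, Fin.ext_iff] using
        tentMatrix_one_mul_single_kronecker (R := R) m a b
    by_cases h' : j = Fin.succ ⟨i, hi⟩
    · subst h'
      rw [Equiv.swap_apply_right]
      simpa [tentMatrix, Fin.lt_def, Fin.ext_iff] using
        tentMatrix_one_mul_kronecker_single (R := R) m a b
    rw [Equiv.swap_apply_of_ne_of_ne h h']
    simp only [Fin.ext_iff, Fin.lt_def, Fin.val_castSucc, Fin.val_succ] at h h' ⊢
    by_cases h3 : i < j
    · rw [if_pos h3, if_pos (by omega), Smat_pow]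
      exact commute_tentMatrix_diagonal 1 1 m _
    · rw [if_neg h3, if_neg (by omega), if_neg (by omega), if_neg (by omega),
        Matrix.one_kronecker_one, one_mul, mul_one]
  · by_cases h : j = Fin.castSucc ⟨i, hi⟩
    · subst h
      rw [Equiv.swap_apply_left]
      simp only [Fin.ext_iff, Fin.lt_def, Fin.val_castSucc, Fin.val_succ] at hl hl' ⊢
      congr 1
      · simp only [eq_iff_iff]; omega
      · rw [if_neg hl, if_neg hl']
    by_cases h' : j = Fin.succ ⟨i, hi⟩
    · subst h'
      rw [Equiv.swap_apply_right]
      simp only [Fin.ext_iff, Fin.lt_def, Fin.val_castSucc, Fin.val_succ] at hl hl' ⊢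
      congr 1
      · simp only [eq_iff_iff]; omega
      · rw [if_neg hl, if_neg hl']
    rw [Equiv.swap_apply_of_ne_of_ne h h']

end Swap

section PlacedUnits

variable {N r : ℕ}

/-- The `q`-integers `[#{j | a j = b}]` as a diagonal operator on the tensor power: the
difference quotient `(Q_b^{⊗ r} - 1) / (q - 1)`. -/
def countOp {R : Type*} [CommRing R] (x : R) (r : ℕ) (b : Fin N) :
    Matrix (Fin r → Fin N) (Fin r → Fin N) R :=
  Matrix.diagonal fun a => ∑ i ∈ Finset.range (Finset.univ.filter fun j => a j = b).card, x ^ i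

theorem rhoQ_eq_smul_countOp_add_one {R : Type*} [CommRing R] (x : R) (b : Fin N) :
    rhoQ x r b = (x - 1) • countOp x r b + 1 := by
  simp only [rhoQ, Qmat_eq_diagonal]
  rw [kron_diagonal, countOp, ← Matrix.diagonal_smul, ← Matrix.diagonal_one, Matrix.diagonal_add]
  congr 1
  funext a
  rw [Pi.smul_apply, smul_eq_mul, mul_geom_sum, sub_add_cancel, Finset.prod_ite,
    Finset.prod_const, Finset.prod_const_one, mul_one]

variable {R : Type*} [CommRing R]

theorem sum_superUnit_self (m : ℕ) (b : Fin N) :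
    ∑ j : Fin r, superUnit R m j b b = countOp 1 r b := by
  have h : ∀ j : Fin r, superUnit R m j b b =
      Matrix.diagonal fun a => if a j = b then 1 else 0 := by
    intro j
    have h1 : superUnit R m j b b = kron fun l => Matrix.diagonal fun c =>
        if l = j then (if c = b then 1 else 0) else 1 := by
      rw [superUnit]
      congr 1
      funext l
      split_ifs with h2 h3 h3
      · exact absurd h3 h2.ne
      · rw [← two_mul, pow_mul, pow_two, Smat_mul_self, one_pow, ← Matrix.diagonal_one]
      · ext c e
        by_cases hc : c = e
        · subst hc
          simp [Matrix.single_apply, eq_comm]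
        · rw [Matrix.diagonal_apply_ne _ hc, Matrix.single_apply, if_neg]
          exact fun h4 => hc (h4.1.symm.trans h4.2)
      · rw [← Matrix.diagonal_one]
    rw [h1, kron_diagonal]
    simp
  ext a c
  by_cases hac : a = c
  · subst hac
    simp [h, countOp, Matrix.sum_apply]
  · simp [h, countOp, Matrix.sum_apply, hac]

theorem SPmat_eq_pow (m k : ℕ) (a b : Fin N) (ha : (a : ℕ) = k) (hb : (b : ℕ) = k + 1) :
    (SPmat R m k : Matrix (Fin N) (Fin N) R) = Smat R m ^ (deg m a + deg m b) := by
  rw [SPmat, deg, deg, ha, hb]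
  rcases lt_trichotomy (k + 1) m with h | h | h
  · simp [h, h.ne, show k < m by omega]
  · simp [h, show k < m by omega]
  · rw [if_neg h.ne', if_neg (by omega), if_neg (by omega), pow_two, Smat_mul_self]

theorem Dmat_one (m k : ℕ) : (Dmat 1 1 m k : Matrix (Fin N) (Fin N) R) = 1 := by
  simp [Dmat_eq_diagonal]

theorem sum_superUnit_eq_rhoE (m k : ℕ) (a b : Fin N) (ha : (a : ℕ) = k) (hb : (b : ℕ) = k + 1) :
    ∑ j : Fin r, superUnit R m j b a = rhoE 1 1 m r k := by
  have h : Emat R k = Matrix.single b a (1 : R) := by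
    ext c e
    simp [Emat, Matrix.single_apply, Fin.ext_iff, ha, hb, eq_comm]
  simp only [rhoE, superUnit, Dinvmat, Dmat_one, SPmat_eq_pow m k a b ha hb, h,
    add_comm (deg m b)]

theorem sum_superUnit_eq_rhoF (m k : ℕ) (a b : Fin N) (ha : (a : ℕ) = k) (hb : (b : ℕ) = k + 1) :
    ∑ j : Fin r, superUnit R m j a b = rhoF 1 1 m r k := by
  have h : Fmat R k = Matrix.single a b (1 : R) := by
    ext c e
    simp [Fmat, Matrix.single_apply, Fin.ext_iff, ha, hb, eq_comm]
  simp only [rhoF, superUnit, Dmat_one, SPmat_eq_pow m k a b ha hb, h, mul_one]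

theorem sum_conj_single_mem (m : ℕ) (G : Subalgebra R (Matrix (Fin r → Fin N) (Fin r → Fin N) R))
    (hG : ∀ a b : Fin N, ∑ j : Fin r, superUnit R m j a b ∈ G)
    (U U' : Equiv.Perm (Fin r) → Matrix (Fin r → Fin N) (Fin r → Fin N) R)
    (hU : ∀ g, U g * U' g = 1)
    (h : ∀ g j a b, U g * superUnit R m j a b = superUnit R m (g j) a b * U g)
    (a b : Fin r → Fin N) : ∑ g, U g * Matrix.single a b 1 * U' g ∈ G := by
  obtain ⟨c, hc⟩ := exists_single_eq_smul_prod_superUnit (R := R) m a b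
  have h1 : ∀ g, U g * Matrix.single a b 1 * U' g =
      c • (List.ofFn fun i => superUnit R m (g i) (a i) (b i)).prod := by
    intro g
    rw [hc, mul_smul_comm, smul_mul_assoc,
      mul_prod_ofFn_of_intertwine (U g) _ _ fun i => h g i (a i) (b i), mul_assoc, hU, mul_one]
  have h2 := placements_empty_mem (K := R) (d := deg m)
    (superUnit_mul_superUnit_same (R := R) (r := r) (N := N) m)
    (fun i j hij => superUnit_mul_superUnit_of_ne m hij) G hG (List.ofFn fun i => (a i, b i))
  rw [placements_ofFn_empty] at h2
  simp only [h1, ← Finset.smul_sum]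
  exact G.smul_mem h2 c

/-- The operators `countOp`, `rhoE` and `rhoF` as one family. Unlike `rhoQ`, the operators
`countOp` still generate the diagonal part after specializing the parameter to `1`. -/
def quantumFamily (x xinv : R) (m r : ℕ) :
    Fin N ⊕ Fin (N - 1) ⊕ Fin (N - 1) → Matrix (Fin r → Fin N) (Fin r → Fin N) R :=
  Sum.elim (countOp x r) (Sum.elim (fun k => rhoE x xinv m r k) fun k => rhoF x xinv m r k)

/-- The Hecke operators, indexed by their positions. -/
def heckeFamily (x xinv : R) (m N r : ℕ) (i : {i : Fin r // (i : ℕ) + 1 < r}) :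
    Matrix (Fin r → Fin N) (Fin r → Fin N) R :=
  heckeOp x xinv m r i.1 i.2

end PlacedUnits

section ClassicalDuality

variable {K : Type*} [Field K] [CharZero K] {N : ℕ}

theorem centralizer_heckeFamily_one_le (m r : ℕ) (hr : 1 ≤ r) :
    Subalgebra.centralizer K (Set.range (heckeFamily (1 : K) 1 m N r)) ≤
      Algebra.adjoin K (Set.range (quantumFamily (1 : K) 1 m r)) := by
  obtain ⟨n, rfl⟩ : ∃ n, r = n + 1 := ⟨r - 1, by omega⟩
  set B := Algebra.adjoin K (Set.range (quantumFamily (N := N) (1 : K) 1 m (n + 1))) with hB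
  set S := Algebra.adjoin K (Set.range (heckeFamily (1 : K) 1 m N (n + 1))) with hS
  have hfam : ∀ p, quantumFamily (N := N) (1 : K) 1 m (n + 1) p ∈ B := fun p =>
    Algebra.subset_adjoin ⟨p, rfl⟩
  have hunit : ∀ a b : Fin N, ∑ j : Fin (n + 1), superUnit K m j a b ∈ B := by
    refine sum_unit_mem (d := deg m) (superUnit_mul_superUnit_same m)
      (fun i j hij => superUnit_mul_superUnit_of_ne m hij) B (fun b => ?_) (fun a b h => ?_)
      fun a b h => ?_
    · rw [sum_superUnit_self]
      exact hfam (Sum.inl b)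
    · rw [sum_superUnit_eq_rhoF m a a b rfl h.symm]
      exact hfam (Sum.inr (Sum.inr ⟨a, by omega⟩))
    · rw [sum_superUnit_eq_rhoE m a a b rfl h.symm]
      exact hfam (Sum.inr (Sum.inl ⟨a, by omega⟩))
  choose U hU U' hU' hUU' hUX using exists_intertwiner (R := K)
    (X := superUnit (r := n + 1) (N := N) K m) S fun i =>
    ⟨heckeOp 1 1 m (n + 1) i (Nat.succ_lt_succ i.isLt),
      Algebra.subset_adjoin ⟨⟨i.castSucc, Nat.succ_lt_succ i.isLt⟩, rfl⟩,
      heckeOp_one_mul_self m _, heckeOp_one_mul_superUnit m i⟩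
  intro Y hY
  have hYS : ∀ Z ∈ S, Z * Y = Y * Z := fun Z hZ =>
    ((Subalgebra.mem_centralizer_iff K).1
      (Algebra.adjoin_le_centralizer_centralizer K _ hZ) Y hY).symm
  have hcard : (Fintype.card (Equiv.Perm (Fin (n + 1))) : K) ≠ 0 :=
    Nat.cast_ne_zero.2 Fintype.card_ne_zero
  have hsum : (Fintype.card (Equiv.Perm (Fin (n + 1))) : K) • Y = ∑ g, U g * Y * U' g := by
    have h : ∀ g, U g * Y * U' g = Y := fun g => by
      rw [hYS _ (hU g), mul_assoc, hUU', mul_one]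
    simp [h, Nat.cast_smul_eq_nsmul]
  rw [← inv_smul_smul₀ hcard Y, hsum]
  refine B.smul_mem ?_ _
  have hexp : ∑ g, U g * Y * U' g =
      ∑ a, ∑ b, Y a b • ∑ g, U g * Matrix.single a b 1 * U' g := by
    conv_lhs => rw [Matrix.matrix_eq_sum_single Y]
    simp only [Finset.smul_sum, Finset.mul_sum, Finset.sum_mul]
    rw [Finset.sum_comm]
    refine Finset.sum_congr rfl fun a _ => ?_
    rw [Finset.sum_comm]
    refine Finset.sum_congr rfl fun b _ => Finset.sum_congr rfl fun g _ => ?_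
    rw [← smul_mul_assoc, ← mul_smul_comm, Matrix.smul_single, smul_eq_mul, mul_one]
  rw [hexp]
  exact B.sum_mem fun a _ => B.sum_mem fun b _ =>
    B.smul_mem (sum_conj_single_mem m B hunit U U' hUU' hUX a b) _

end ClassicalDuality

section ClassicalDuality

variable {N : ℕ}

theorem transpose_heckeOp {R : Type*} [CommRing R] (x xinv : R) (m r i : ℕ) (h : i + 1 < r) :
    (heckeOp x xinv m (N := N) r i h).transpose = heckeOp x xinv m r i h := by
  ext a b
  simp only [Matrix.transpose_apply, heckeOp, twoSiteOp]
  rw [Tent_symm]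
  simp only [eq_comm]

theorem Matrix.transpose_mem_adjoin {R I : Type*} [CommRing R] [Fintype I] [DecidableEq I]
    {s : Set (Matrix I I R)} (hs : ∀ X ∈ s, X.transpose ∈ s) {X : Matrix I I R}
    (hX : X ∈ Algebra.adjoin R s) : X.transpose ∈ Algebra.adjoin R s := by
  induction hX using Algebra.adjoin_induction with
  | mem X hX => exact Algebra.subset_adjoin (hs X hX)
  | algebraMap c =>
    rw [Matrix.algebraMap_eq_diagonal, Matrix.diagonal_transpose, ← Matrix.algebraMap_eq_diagonal]
    exact Subalgebra.algebraMap_mem _ c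
  | add X Y _ _ hX hY =>
    rw [Matrix.transpose_add]
    exact add_mem hX hY
  | mul X Y _ _ hX hY =>
    rw [Matrix.transpose_mul]
    exact mul_mem hY hX

theorem centralizer_quantumFamily_one_le {K : Type*} [Field K] [LinearOrder K]
    [IsStrictOrderedRing K] (m r : ℕ) (hr : 1 ≤ r) :
    Subalgebra.centralizer K (Set.range (quantumFamily (N := N) (1 : K) 1 m r)) ≤
      Algebra.adjoin K (Set.range (heckeFamily (1 : K) 1 m N r)) := by
  refine le_trans ?_ (Subalgebra.centralizer_centralizer_le_of_transpose_mem _ fun X hX =>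
    Matrix.transpose_mem_adjoin ?_ hX)
  · intro X hX
    rw [Subalgebra.mem_centralizer_iff]
    intro Y hY
    have hY' : Y ∈ Subalgebra.centralizer K (Set.range (heckeFamily (1 : K) 1 m N r)) :=
      Subalgebra.centralizer_le K _ _ Algebra.subset_adjoin hY
    exact ((Subalgebra.mem_centralizer_iff K).1 (Algebra.adjoin_le_centralizer_centralizer K _
      (centralizer_heckeFamily_one_le m r hr hY')) X hX).symm
  · rintro _ ⟨i, rfl⟩
    exact ⟨i, (transpose_heckeOp _ _ _ _ _ _).symm⟩

end ClassicalDuality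

section BaseChange

variable {R S : Type*} [CommRing R] [CommRing S] (f : R →+* S) {N r : ℕ}

theorem heckeFamily_map (x xinv : R) (m : ℕ) (i : {i : Fin r // (i : ℕ) + 1 < r}) :
    (heckeFamily x xinv m N r i).map f = heckeFamily (f x) (f xinv) m N r i := by
  ext a b
  simp only [heckeFamily, heckeOp, twoSiteOp, Tent, sgn, Matrix.map_apply, map_mul, map_prod]
  congr 1
  · split_ifs <;> simp
  · exact Finset.prod_congr rfl fun j _ => by split_ifs <;> simp

theorem kron_map (M : Fin r → Matrix (Fin N) (Fin N) R) :
    (kron M).map f = kron fun j => (M j).map f := by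
  ext a b
  simp [kron]

theorem sum_kron_map (A B C : Matrix (Fin N) (Fin N) R) :
    (∑ p : Fin r, kron fun j => if j < p then A else if j = p then B else C).map f =
      ∑ p : Fin r, kron fun j => if j < p then A.map f else if j = p then B.map f else C.map f := by
  have h := map_sum f.mapMatrix
    (fun p : Fin r => kron fun j => if j < p then A else if j = p then B else C) Finset.univ
  simp only [RingHom.mapMatrix_apply] at h
  rw [h]
  refine Finset.sum_congr rfl fun p _ => ?_
  rw [kron_map]
  congr 1
  funext j
  split_ifs <;> rfl

theorem SPmat_map (m k : ℕ) : (SPmat R m (N := N) k).map f = SPmat S m k := by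
  rw [SPmat_eq_diagonal, SPmat_eq_diagonal, Matrix.diagonal_map (map_zero f)]
  congr 1
  funext a
  split_ifs <;> simp

theorem Dmat_map (x xinv : R) (m k : ℕ) :
    (Dmat x xinv m (N := N) k).map f = Dmat (f x) (f xinv) m k := by
  rw [Dmat_eq_diagonal, Dmat_eq_diagonal, Matrix.diagonal_map (map_zero f)]
  congr 1
  funext a
  split_ifs <;> simp

theorem Emat_map (k : ℕ) : (Emat R (N := N) k).map f = Emat S k := by
  ext a b
  simp only [Emat, Matrix.map_apply]
  split_ifs <;> simp

theorem Fmat_map (k : ℕ) : (Fmat R (N := N) k).map f = Fmat S k := by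
  ext a b
  simp only [Fmat, Matrix.map_apply]
  split_ifs <;> simp

theorem quantumFamily_map (x xinv : R) (m : ℕ) (p : Fin N ⊕ Fin (N - 1) ⊕ Fin (N - 1)) :
    (quantumFamily x xinv m r p).map f = quantumFamily (f x) (f xinv) m r p := by
  rcases p with b | k | k
  · simp only [quantumFamily, Sum.elim_inl, countOp]
    rw [Matrix.diagonal_map (map_zero f)]
    congr 1
    funext a
    simp
  · simp only [quantumFamily, Sum.elim_inl, Sum.elim_inr, rhoE, Dinvmat]
    rw [sum_kron_map, SPmat_map, Emat_map, Dmat_map]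
  · simp only [quantumFamily, Sum.elim_inr, rhoF]
    rw [sum_kron_map, Matrix.map_mul, SPmat_map, Fmat_map, Dmat_map,
      Matrix.map_one f (map_zero f) (map_one f)]

end BaseChange

section Transcendental

open scoped LaurentPolynomial

/-- Specialization of a Laurent polynomial at `1`. -/
noncomputable def LaurentPolynomial.evalOne (K : Type*) [Field K] : K[T;T⁻¹] →ₐ[K] K :=
  { LaurentPolynomial.eval₂ (RingHom.id K) 1 with
    commutes' := fun c => LaurentPolynomial.eval₂_C _ _ c }

theorem LaurentPolynomial.evalOne_T (K : Type*) [Field K] (n : ℤ) :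
    LaurentPolynomial.evalOne K (LaurentPolynomial.T n) = 1 := by
  change LaurentPolynomial.eval₂ (RingHom.id K) 1 (LaurentPolynomial.T n) = 1
  simp [LaurentPolynomial.eval₂_T]

theorem LaurentPolynomial.eval₂_injective_of_transcendental {K L : Type*} [Field K] [Field L]
    [Algebra K L] {t : Lˣ} (ht : Transcendental K (t : L)) :
    Function.Injective (LaurentPolynomial.eval₂ (algebraMap K L) t) := by
  rw [injective_iff_map_eq_zero]
  intro f hf
  obtain ⟨n, f', hf'⟩ := LaurentPolynomial.exists_T_pow f
  have h : Polynomial.aeval (t : L) f' = 0 := by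
    rw [Polynomial.aeval_def, ← LaurentPolynomial.eval₂_toLaurent, hf', map_mul, hf, zero_mul]
  rw [transcendental_iff.1 ht f' h, map_zero] at hf'
  exact ((LaurentPolynomial.isUnit_T n).mul_left_eq_zero).1 hf'.symm

end Transcendental

section Main

variable {N : ℕ}

theorem adjoin_quantumGens_le_centralizer {R : Type*} [CommRing R] {x xinv : R}
    (hx : x * xinv = 1) (m r : ℕ) :
    Algebra.adjoin R (quantumGens x xinv m (N := N) r) ≤
      Subalgebra.centralizer R (Set.range (heckeFamily x xinv m N r)) := by
  refine Algebra.adjoin_le fun M hM => ?_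
  rw [SetLike.mem_coe, Subalgebra.mem_centralizer_iff]
  rintro _ ⟨i, rfl⟩
  exact (commute_heckeOp_of_mem_quantumGens hx m i.2 hM).eq

theorem adjoin_quantumFamily_le {K : Type*} [Field K] {x : K} (hx : x ≠ 1) (xinv : K) (m r : ℕ) :
    Algebra.adjoin K (Set.range (quantumFamily (N := N) x xinv m r)) ≤
      Algebra.adjoin K (quantumGens x xinv m r) := by
  refine Algebra.adjoin_le ?_
  rintro _ ⟨b | k | k, rfl⟩
  · have h : countOp x r b = (x - 1)⁻¹ • (rhoQ x r b - 1) := by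
      rw [rhoQ_eq_smul_countOp_add_one, add_sub_cancel_right, inv_smul_smul₀ (sub_ne_zero.2 hx)]
    rw [quantumFamily, Sum.elim_inl, h]
    refine Subalgebra.smul_mem _ (sub_mem (Algebra.subset_adjoin ?_) (one_mem _)) _
    exact Or.inl (Or.inl (Or.inl (Or.inr ⟨b, rfl⟩)))
  · exact Algebra.subset_adjoin (Or.inl (Or.inr ⟨k, rfl⟩))
  · exact Algebra.subset_adjoin (Or.inr ⟨k, rfl⟩)

theorem range_heckeFamily {R : Type*} [CommRing R] (x xinv : R) (m r : ℕ) :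
    Set.range (heckeFamily x xinv m N r) = heckeGens x xinv m r := by
  ext M
  constructor
  · rintro ⟨i, rfl⟩
    exact ⟨i.1, i.2, rfl⟩
  · rintro ⟨i, h, rfl⟩
    exact ⟨⟨⟨i, Nat.lt_of_succ_lt h⟩, h⟩, rfl⟩

theorem adjoin_quantumGens_heckeGens_duality {K L : Type*} [Field K] [LinearOrder K]
    [IsStrictOrderedRing K] [Field L] [Algebra K L] {t : L} (ht : Transcendental K t)
    (m r : ℕ) (hr : 1 ≤ r) :
    Algebra.adjoin L (quantumGens t t⁻¹ m (N := N) r) =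
        Subalgebra.centralizer L (Algebra.adjoin L (heckeGens t t⁻¹ m (N := N) r) : Set _) ∧
      Algebra.adjoin L (heckeGens t t⁻¹ m (N := N) r) =
        Subalgebra.centralizer L (Algebra.adjoin L (quantumGens t t⁻¹ m (N := N) r) : Set _) := by
  have ht0 : t ≠ 0 := by
    rintro rfl
    exact ht isAlgebraic_zero
  have ht1 : t ≠ 1 := by
    rintro rfl
    exact ht isAlgebraic_one
  obtain ⟨u, rfl⟩ : ∃ u : Lˣ, (u : L) = t := ⟨Units.mk0 t ht0, rfl⟩
  rw [← range_heckeFamily]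
  set S := Algebra.adjoin L (Set.range (heckeFamily (u : L) (u : L)⁻¹ m N r)) with hS
  set G := Algebra.adjoin L (quantumGens (u : L) (u : L)⁻¹ m (N := N) r) with hG
  set B := Algebra.adjoin L (Set.range (quantumFamily (N := N) (u : L) (u : L)⁻¹ m r)) with hB
  let φ := LaurentPolynomial.evalOne K
  let ψ := LaurentPolynomial.eval₂ (algebraMap K L) u
  have hψ : Function.Injective ψ := LaurentPolynomial.eval₂_injective_of_transcendental ht
  let g := heckeFamily (LaurentPolynomial.T (R := K) 1) (LaurentPolynomial.T (-1)) m N r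
  let h := quantumFamily (N := N) (LaurentPolynomial.T (R := K) 1) (LaurentPolynomial.T (-1)) m r
  have hgφ : (fun i => (g i).map φ) = heckeFamily 1 1 m N r := by
    funext i
    exact (heckeFamily_map φ.toRingHom _ _ m i).trans
      (congrArg₂ (fun x y => heckeFamily x y m N r i) (LaurentPolynomial.evalOne_T K _)
        (LaurentPolynomial.evalOne_T K _))
  have hhφ : (fun i => (h i).map φ) = quantumFamily 1 1 m r := by
    funext i
    exact (quantumFamily_map φ.toRingHom _ _ m i).trans
      (congrArg₂ (fun x y => quantumFamily x y m r i) (LaurentPolynomial.evalOne_T K _)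
        (LaurentPolynomial.evalOne_T K _))
  have hψ1 : ψ (LaurentPolynomial.T 1) = u := by simp [ψ, LaurentPolynomial.eval₂_T]
  have hψ2 : ψ (LaurentPolynomial.T (-1)) = (u : L)⁻¹ := by simp [ψ, LaurentPolynomial.eval₂_T]
  have hgψ : (fun i => (g i).map ψ) = heckeFamily (u : L) (u : L)⁻¹ m N r := by
    funext i
    rw [heckeFamily_map, hψ1, hψ2]
  have hhψ : (fun i => (h i).map ψ) = quantumFamily (u : L) (u : L)⁻¹ m r := by
    funext i
    rw [quantumFamily_map, hψ1, hψ2]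
  have hBG : B ≤ G := adjoin_quantumFamily_le ht1 _ m r
  have hGS : G ≤ Subalgebra.centralizer L (S : Set _) := by
    intro Y hY
    rw [Subalgebra.mem_centralizer_iff]
    intro Z hZ
    exact ((Subalgebra.mem_centralizer_iff L).1 (Algebra.adjoin_le_centralizer_centralizer L _ hZ)
      Y (adjoin_quantumGens_le_centralizer (mul_inv_cancel₀ u.ne_zero) m r hY)).symm
  have hBS : B = Subalgebra.centralizer L (Set.range (heckeFamily (u : L) (u : L)⁻¹ m N r)) := by
    have := adjoin_eq_centralizer_of_specialization φ ψ hψ h g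
    rw [hgφ, hhφ, hgψ, hhψ] at this
    exact this (hBG.trans (adjoin_quantumGens_le_centralizer (mul_inv_cancel₀ u.ne_zero) m r))
      (centralizer_heckeFamily_one_le m r hr)
  have hSB : S = Subalgebra.centralizer L
      (Set.range (quantumFamily (N := N) (u : L) (u : L)⁻¹ m r)) := by
    have := adjoin_eq_centralizer_of_specialization φ ψ hψ g h
    rw [hgφ, hhφ, hgψ, hhψ] at this
    refine this (fun Z hZ => ?_) (centralizer_quantumFamily_one_le m r hr)
    rw [Subalgebra.mem_centralizer_iff]
    intro Y hY
    exact ((Subalgebra.mem_centralizer_iff L).1 (hGS (hBG (Algebra.subset_adjoin hY))) Z hZ).symm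
  have hGB : G = B := le_antisymm (by
    rw [hBS]
    exact adjoin_quantumGens_le_centralizer (mul_inv_cancel₀ u.ne_zero) m r) hBG
  constructor
  · refine le_antisymm hGS ?_
    rw [hGB, hBS]
    exact Subalgebra.centralizer_le L _ _ Algebra.subset_adjoin
  · refine le_antisymm (fun Z hZ => ?_) ?_
    · rw [Subalgebra.mem_centralizer_iff]
      intro Y hY
      exact ((Subalgebra.mem_centralizer_iff L).1 (hGS hY) Z hZ).symm
    · rw [hGB, hSB]
      exact Subalgebra.centralizer_le L _ _ Algebra.subset_adjoin

theorem Subalgebra.coe_centralizer_eq_setOf {R A : Type*} [CommRing R] [Ring A] [Algebra R A]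
    (s : Set A) : (Subalgebra.centralizer R s : Set A) = {X | ∀ Y ∈ s, X * Y = Y * X} := by
  ext X
  simp only [SetLike.mem_coe, Subalgebra.mem_centralizer_iff, Set.mem_ofPred_eq, eq_comm]

end Main

/-- For `t ∈ ℂ` transcendental over `ℚ`, the specialized algebras
`𝒢_t` and `𝒮_t` are mutual centralizers in `Mat_{(m+n)^r}(ℂ)`. -/
theorem Gt_St_mutual_centralizers (t : ℂ) (ht : Transcendental ℚ t)
    (m n r : ℕ) (hm : 1 ≤ m) (hn : 1 ≤ n) (hr : 2 ≤ r) :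
    ((Gt t m n r : Set (Matrix (Fin r → Fin (m + n)) (Fin r → Fin (m + n)) ℂ))
        = {X | ∀ Y ∈ (St t m n r :
            Set (Matrix (Fin r → Fin (m + n)) (Fin r → Fin (m + n)) ℂ)), X * Y = Y * X})
    ∧ ((St t m n r : Set (Matrix (Fin r → Fin (m + n)) (Fin r → Fin (m + n)) ℂ))
        = {X | ∀ Y ∈ (Gt t m n r :
            Set (Matrix (Fin r → Fin (m + n)) (Fin r → Fin (m + n)) ℂ)), X * Y = Y * X}) := by
  obtain ⟨h1, h2⟩ := adjoin_quantumGens_heckeGens_duality (N := m + n) ht m r (by omega)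
  exact ⟨(congrArg SetLike.coe h1).trans (Subalgebra.coe_centralizer_eq_setOf _),
    (congrArg SetLike.coe h2).trans (Subalgebra.coe_centralizer_eq_setOf _)⟩
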